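/- arXiv:2603.01244 — 5 statements merged into one kernel-verified Lean document; each statement's English description precedes it below -/
import Mathlib

section
/- Let P = ⟨p_1, …, p_n⟩ be a sequence of positive integers whose total sum Σ is even, such that every p_i < Σ/2 and no nonempty prefix of P sums to Σ/2. Let t = Σ/2, let G be the graph on four vertices {v_1, v_2, v_3, v_4} whose only edges are v_1v_2 and v_3v_4, and let S = ⟨(c, p_1), …, (c, p_n)⟩ for a single color c. Then S is emptyable on (G, t) if and only if there is a subset I ⊆ {1, …, n} with Σ_{i∈I} p_i = Σ/2. -/
open scoped Classical

namespace Hexasort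

/-- A board configuration: each vertex holds either a stack `(color, height)` or nothing. -/
abbrev Config (V C : Type*) := V → Option (C × ℕ)

/-- The everywhere-empty configuration. -/
def emptyConfig (V C : Type*) : Config V C := fun _ => none

/-- The height contributed by a board entry to color `c` (0 if empty or another color). -/
noncomputable def colorHeight {C : Type*} (e : Option (C × ℕ)) (c : C) : ℕ :=
  match e with
  | none => 0
  | some (c', h) => if c' = c then h else 0

/-- Total height of the color-`c` stacks on the neighbors of `x`. -/
noncomputable def neighborSum {V C : Type*} [Fintype V] (G : SimpleGraph V)
    (δ : Config V C) (c : C) (x : V) : ℕ :=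
  ∑ y ∈ Finset.univ.filter (fun y => G.Adj x y), colorHeight (δ y) c

/-- The configuration resulting from placing the stack `s` on the vertex `x`:
all same-colored neighbors are emptied, and `x` gets the merged stack unless
its total height reaches the threshold `t`, in which case `x` becomes empty. -/
noncomputable def place {V C : Type*} [Fintype V] (G : SimpleGraph V) (t : ℕ)
    (δ : Config V C) (s : C × ℕ) (x : V) : Config V C :=
  fun v =>
    if v = x then
      (if t ≤ s.2 + neighborSum G δ s.1 x then none
       else some (s.1, s.2 + neighborSum G δ s.1 x))
    else if G.Adj x v ∧ (∃ hh, δ v = some (s.1, hh)) then none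
    else δ v

/-- Play a sequence of stacks on a sequence of vertices, starting from `δ`. -/
noncomputable def play {V C : Type*} [Fintype V] (G : SimpleGraph V) (t : ℕ) :
    Config V C → List (C × ℕ) → List V → Config V C
  | δ, [], _ => δ
  | δ, _ :: _, [] => δ
  | δ, s :: S, x :: p => play G t (place G t δ s x) S p

/-- Legality of playing the stacks `S` on the vertices `p`, starting from `δ`:
each stack is placed on a vertex that is empty at that moment. -/
inductive Legal {V C : Type*} [Fintype V] (G : SimpleGraph V) (t : ℕ) :
    Config V C → List (C × ℕ) → List V → Prop
  | nil (δ : Config V C) : Legal G t δ [] []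
  | cons {δ : Config V C} (s : C × ℕ) (S : List (C × ℕ)) (x : V) (p : List V) :
      δ x = none → Legal G t (place G t δ s x) S p →
      Legal G t δ (s :: S) (x :: p)

/-- `S` is fittable on `(G, t)`: all stacks can be placed in order. -/
def Fittable {V C : Type*} [Fintype V] (G : SimpleGraph V) (t : ℕ)
    (S : List (C × ℕ)) : Prop :=
  ∃ p : List V, Legal G t (emptyConfig V C) S p

/-- `S` is emptyable on `(G, t)`: all stacks can be placed in order so that the
final configuration is everywhere empty. -/
def Emptyable {V C : Type*} [Fintype V] (G : SimpleGraph V) (t : ℕ)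
    (S : List (C × ℕ)) : Prop :=
  ∃ p : List V, Legal G t (emptyConfig V C) S p ∧
    play G t (emptyConfig V C) S p = emptyConfig V C

end Hexasort

namespace Hexasort

/-- The graph on four vertices whose only edges are `v₁v₂` and `v₃v₄`. -/
def twoEdges : SimpleGraph (Fin 4) :=
  SimpleGraph.fromRel (fun a b => (a = 0 ∧ b = 1) ∨ (a = 2 ∧ b = 3))

theorem adj_aux (x y : Fin 4) : twoEdges.Adj x y ↔
    ((x = 0 ∧ y = 1) ∨ (x = 1 ∧ y = 0) ∨ (x = 2 ∧ y = 3) ∨ (x = 3 ∧ y = 2)) := by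
  unfold twoEdges
  rw [SimpleGraph.fromRel_adj]
  revert x y
  decide

/-- One edge of the board holds total height `a`. -/
def EdgeSt (u v : Option (Unit × ℕ)) (a : ℕ) : Prop :=
  (a = 0 ∧ u = none ∧ v = none) ∨ (0 < a ∧ u = some ((), a) ∧ v = none) ∨
    (0 < a ∧ u = none ∧ v = some ((), a))

/-- The board holds heights `a` and `b` on its two edges. -/
def BoardSt (δ : Config (Fin 4) Unit) (a b : ℕ) : Prop :=
  EdgeSt (δ 0) (δ 1) a ∧ EdgeSt (δ 2) (δ 3) b

/-- Height of an edge after a placement. -/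
def upd (t a p : ℕ) : ℕ := if t ≤ p + a then 0 else p + a

theorem nsum_aux (δ : Config (Fin 4) Unit) :
    neighborSum twoEdges δ () 0 = colorHeight (δ 1) () ∧
    neighborSum twoEdges δ () 1 = colorHeight (δ 0) () ∧
    neighborSum twoEdges δ () 2 = colorHeight (δ 3) () ∧
    neighborSum twoEdges δ () 3 = colorHeight (δ 2) () := by
  simp [neighborSum, adj_aux, Finset.sum_filter, Fin.sum_univ_four]

theorem step_aux (t p a b : ℕ) (hp : 0 < p) (δ : Config (Fin 4) Unit)
    (h : BoardSt δ a b) (x : Fin 4) (hx : δ x = none) :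
    (x.val < 2 → BoardSt (place twoEdges t δ ((), p) x) (upd t a p) b) ∧
    (2 ≤ x.val → BoardSt (place twoEdges t δ ((), p) x) a (upd t b p)) := by
  obtain ⟨n0, n1, n2, n3⟩ := nsum_aux δ
  obtain ⟨h1, h2⟩ := h
  have ha : EdgeSt (δ 0) (δ 1) a := h1
  have hb : EdgeSt (δ 2) (δ 3) b := h2
  unfold EdgeSt at h1 h2
  fin_cases x
  · simp only [Fin.zero_eta] at *
    refine ⟨fun _ => ⟨?_, ?_⟩, fun h => by simp at h⟩
    · rcases h1 with ⟨r, u, v⟩ | ⟨r, u, v⟩ | ⟨r, u, v⟩ <;> by_cases ht : t ≤ p + a <;>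
        simp_all [place, adj_aux, EdgeSt, upd, colorHeight] <;>
        (split_ifs <;> omega)
    · simpa [place, adj_aux] using hb
  · simp only [Fin.mk_one] at *
    refine ⟨fun _ => ⟨?_, ?_⟩, fun h => by simp at h⟩
    · rcases h1 with ⟨r, u, v⟩ | ⟨r, u, v⟩ | ⟨r, u, v⟩ <;> by_cases ht : t ≤ p + a <;>
        simp_all [place, adj_aux, EdgeSt, upd, colorHeight] <;>
        (split_ifs <;> omega)
    · simpa [place, adj_aux] using hb
  · simp only [Fin.reduceFinMk] at *
    refine ⟨fun h => by simp at h, fun _ => ⟨?_, ?_⟩⟩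
    · simpa [place, adj_aux] using ha
    · rcases h2 with ⟨r, u, v⟩ | ⟨r, u, v⟩ | ⟨r, u, v⟩ <;> by_cases ht : t ≤ p + b <;>
        simp_all [place, adj_aux, EdgeSt, upd, colorHeight] <;>
        (split_ifs <;> omega)
  · simp only [Fin.reduceFinMk] at *
    refine ⟨fun h => by simp at h, fun _ => ⟨?_, ?_⟩⟩
    · simpa [place, adj_aux] using ha
    · rcases h2 with ⟨r, u, v⟩ | ⟨r, u, v⟩ | ⟨r, u, v⟩ <;> by_cases ht : t ≤ p + b <;>
        simp_all [place, adj_aux, EdgeSt, upd, colorHeight] <;>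
        (split_ifs <;> omega)

/-- Abstract game on the two edge heights. -/
def Win (t : ℕ) : ℕ → ℕ → List ℕ → Prop
  | a, b, [] => a = 0 ∧ b = 0
  | a, b, p :: Q => Win t (upd t a p) b Q ∨ Win t a (upd t b p) Q

theorem board_zero (δ : Config (Fin 4) Unit) (a b : ℕ) (h : BoardSt δ a b) :
    δ = emptyConfig (Fin 4) Unit ↔ (a = 0 ∧ b = 0) := by
  obtain ⟨h1, h2⟩ := h
  unfold EdgeSt at h1 h2
  constructor
  · rintro rfl
    simp [emptyConfig] at h1 h2
    exact ⟨h1, h2⟩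
  · rintro ⟨rfl, rfl⟩
    simp at h1 h2
    funext v
    fin_cases v <;> simp [emptyConfig, h1, h2]

theorem win_iff (t : ℕ) (Q : List ℕ) : ∀ (hQ : ∀ x ∈ Q, 0 < x) (a b : ℕ)
    (δ : Config (Fin 4) Unit) (_ : BoardSt δ a b),
    (∃ p : List (Fin 4), Legal twoEdges t δ (Q.map (fun h => (((), h) : Unit × ℕ))) p ∧
      play twoEdges t δ (Q.map (fun h => (((), h) : Unit × ℕ))) p = emptyConfig (Fin 4) Unit)
      ↔ Win t a b Q := by
  induction Q with
  | nil =>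
    intro _ a b δ h
    simp only [List.map_nil, Win, play, ← board_zero δ a b h]
    exact ⟨fun ⟨_, _, h⟩ => h, fun h => ⟨[], Legal.nil _, h⟩⟩
  | cons q Q ih =>
    intro hQ a b δ h
    have hq : 0 < q := hQ q (by simp)
    have ih := ih (fun x hx => hQ x (by simp [hx]))
    simp only [List.map_cons, Win]
    constructor
    · rintro ⟨p, hl, hp⟩
      cases hl with
      | cons _ _ x p hx hl =>
        simp only [play] at hp
        have hs := step_aux t q a b hq δ h x hx
        by_cases hx2 : x.val < 2
        · exact Or.inl ((ih _ _ _ (hs.1 hx2)).1 ⟨p, hl, hp⟩)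
        · exact Or.inr ((ih _ _ _ (hs.2 (by omega))).1 ⟨p, hl, hp⟩)
    · rintro (hw | hw)
      · obtain ⟨x, hx, hx2⟩ : ∃ x : Fin 4, δ x = none ∧ x.val < 2 := by
          rcases h.1 with ⟨r, u, v⟩ | ⟨r, u, v⟩ | ⟨r, u, v⟩
          · exact ⟨0, u, by simp⟩
          · exact ⟨1, v, by simp⟩
          · exact ⟨0, u, by simp⟩
        obtain ⟨p, hl, hp⟩ := (ih _ _ _ ((step_aux t q a b hq δ h x hx).1 hx2)).2 hw
        exact ⟨x :: p, Legal.cons _ _ _ _ hx hl, hp⟩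
      · obtain ⟨x, hx, hx2⟩ : ∃ x : Fin 4, δ x = none ∧ 2 ≤ x.val := by
          rcases h.2 with ⟨r, u, v⟩ | ⟨r, u, v⟩ | ⟨r, u, v⟩
          · exact ⟨2, u, by simp⟩
          · exact ⟨3, v, by simp⟩
          · exact ⟨2, u, by simp⟩
        obtain ⟨p, hl, hp⟩ := (ih _ _ _ ((step_aux t q a b hq δ h x hx).2 hx2)).2 hw
        exact ⟨x :: p, Legal.cons _ _ _ _ hx hl, hp⟩

theorem win_ge (t : ℕ) (Q : List ℕ) : ∀ a b, Win t a b Q → 0 < a + b + Q.sum →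
    t ≤ a + b + Q.sum := by
  induction Q with
  | nil => intro a b h h'; simp [Win] at h h'; omega
  | cons p Q ih =>
    intro a b h h'
    rw [List.sum_cons] at *
    rcases h with h | h
    · have := ih _ _ h
      unfold upd at this
      split_ifs at this <;> omega
    · have := ih _ _ h
      unfold upd at this
      split_ifs at this <;> omega

theorem win_sub (t : ℕ) (ht : 0 < t) (Q : List ℕ) : ∀ a b, a < t → b < t → (∀ x ∈ Q, x < t) →
    Win t a b Q → a + b + Q.sum = 2 * t →
    ∃ L : List ℕ, L.Sublist Q ∧ (a + L.sum = t ∨ b + L.sum = t) := by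
  induction Q with
  | nil => intro a b _ _ _ h h'; simp [Win] at h h'; omega
  | cons p Q ih =>
    intro a b ha hb hQ h h'
    have hp := hQ p (by simp)
    have hQ' : ∀ x ∈ Q, x < t := fun x hx => hQ x (by simp [hx])
    rw [List.sum_cons] at h'
    rcases h with h | h
    · by_cases hc : t ≤ p + a
      · rw [upd, if_pos hc] at h
        have := win_ge t Q _ _ h (by omega)
        exact ⟨[p], by simp, Or.inl (by simp; omega)⟩
      · rw [upd, if_neg hc] at h
        obtain ⟨L, hL, h1 | h1⟩ := ih _ _ (by omega) hb hQ' h (by omega)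
        · exact ⟨p :: L, hL.cons_cons p, Or.inl (by simp; omega)⟩
        · exact ⟨L, hL.cons p, Or.inr h1⟩
    · by_cases hc : t ≤ p + b
      · rw [upd, if_pos hc] at h
        have := win_ge t Q _ _ h (by omega)
        exact ⟨[p], by simp, Or.inr (by simp; omega)⟩
      · rw [upd, if_neg hc] at h
        obtain ⟨L, hL, h1 | h1⟩ := ih _ _ ha (by omega) hQ' h (by omega)
        · exact ⟨L, hL.cons p, Or.inl h1⟩
        · exact ⟨p :: L, hL.cons_cons p, Or.inr (by simp; omega)⟩

theorem sub_win (t : ℕ) (ht : 0 < t) (L Q : List ℕ) (hL : L.Sublist Q) : ∀ a b s, a < t → b < t →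
    L.sum + s = Q.sum → (a + L.sum = t ∨ a + L.sum = 0) → (b + s = t ∨ b + s = 0) →
    Win t a b Q := by
  induction hL with
  | slnil => intro a b s; simp [Win]; omega
  | @cons L Q p hL ih =>
    intro a b s ha hb hs h1 h2
    have := hL.sum_le_sum (by simp)
    rw [List.sum_cons] at hs
    right
    by_cases hc : t ≤ p + b
    · rw [upd, if_pos hc]
      exact ih _ _ (s - p) ha ht (by omega) h1 (by omega)
    · rw [upd, if_neg hc]
      exact ih _ _ (s - p) ha (by omega) (by omega) h1 (by omega)
  | @cons_cons L Q p hL ih =>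
    intro a b s ha hb hs h1 h2
    rw [List.sum_cons] at hs h1
    rw [List.sum_cons] at hs
    left
    by_cases hc : t ≤ p + a
    · rw [upd, if_pos hc]
      exact ih _ _ s ht hb (by omega) (by omega) h2
    · rw [upd, if_neg hc]
      exact ih _ _ s (by omega) hb (by omega) (by omega) h2

theorem fin_to_sub (P : List ℕ) : ∀ f : Fin P.length → Prop,
    ∃ L : List ℕ, L.Sublist P ∧ L.sum = ∑ i, if f i then P.get i else 0 := by
  induction P with
  | nil => intro f; exact ⟨[], by simp, by simp⟩
  | cons p P ih =>
    intro f
    obtain ⟨L, hL, hs⟩ := ih (fun i => f i.succ)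
    by_cases h : f 0
    · refine ⟨p :: L, hL.cons_cons p, ?_⟩
      erw [Fin.sum_univ_succ]
      rw [if_pos h, List.sum_cons, hs]; rfl
    · refine ⟨L, hL.cons p, ?_⟩
      erw [Fin.sum_univ_succ]
      rw [if_neg h, hs, zero_add]; rfl

theorem sub_to_fin (L P : List ℕ) (hL : L.Sublist P) :
    ∃ f : Fin P.length → Prop, L.sum = ∑ i, if f i then P.get i else 0 := by
  induction hL with
  | slnil => exact ⟨fun _ => True, by simp⟩
  | @cons L Q p hL ih =>
    obtain ⟨f, hf⟩ := ih
    refine ⟨Fin.cons (α := fun _ => Prop) False f, ?_⟩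
    erw [Fin.sum_univ_succ]
    simpa using hf
  | @cons_cons L Q p hL ih =>
    obtain ⟨f, hf⟩ := ih
    refine ⟨Fin.cons (α := fun _ => Prop) True f, ?_⟩
    erw [Fin.sum_univ_succ]
    simpa using hf

/-- reduction from Partition to Empty Hexasort on two independent edges. -/
theorem statement_0 (P : List ℕ) (hpos : ∀ x ∈ P, 0 < x)
    (heven : 2 ∣ P.sum)
    (hlt : ∀ x ∈ P, x < P.sum / 2)
    (hpre : ∀ Q : List ℕ, Q <+: P → Q ≠ [] → Q.sum ≠ P.sum / 2) :
    Emptyable twoEdges (P.sum / 2) (P.map (fun h => (((), h) : Unit × ℕ))) ↔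
      ∃ I : Finset (Fin P.length), ∑ i ∈ I, P.get i = P.sum / 2 := by
  have hsub : (∃ I : Finset (Fin P.length), ∑ i ∈ I, P.get i = P.sum / 2) ↔
      ∃ L : List ℕ, L.Sublist P ∧ L.sum = P.sum / 2 := by
    constructor
    · rintro ⟨I, hI⟩
      obtain ⟨L, hL, hs⟩ := fin_to_sub P (fun i => i ∈ I)
      refine ⟨L, hL, ?_⟩
      rw [hs, ← hI]
      simp
    · rintro ⟨L, hL, hs⟩
      obtain ⟨f, hf⟩ := sub_to_fin L P hL
      refine ⟨Finset.univ.filter f, ?_⟩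
      rw [Finset.sum_filter, ← hf, hs]
  have hw : Emptyable twoEdges (P.sum / 2) (P.map (fun h => (((), h) : Unit × ℕ))) ↔
      Win (P.sum / 2) 0 0 P :=
    win_iff _ P hpos 0 0 _ ⟨Or.inl ⟨rfl, rfl, rfl⟩, Or.inl ⟨rfl, rfl, rfl⟩⟩
  rw [hsub, hw]
  rcases P with _ | ⟨q, Q⟩
  · simp [Win]
  · have ht : 0 < (q :: Q).sum / 2 := lt_of_le_of_lt (Nat.zero_le _) (hlt q (by simp))
    constructor
    · intro h
      obtain ⟨L, hL, h1⟩ := win_sub _ ht _ 0 0 ht ht hlt h (by omega)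
      exact ⟨L, hL, by omega⟩
    · rintro ⟨L, hL, h1⟩
      exact sub_win _ ht L _ hL 0 0 ((q :: Q).sum / 2) ht ht (by omega) (by omega) (by omega)

end Hexasort
end

section
/- Let P = ⟨p_1, …, p_n⟩ be a sequence of positive integers whose total sum Σ is even, such that every p_i < Σ/2 and no nonempty prefix of P sums to Σ/2. Let t = Σ/2 and let G be the graph consisting of a single edge (two adjacent vertices). Then the sequence S = ⟨(c, p_1), …, (c, p_n)⟩ for a single color c is not emptyable on (G, t). -/
open scoped Classical

namespace Hexasort

theorem total_place (t : ℕ) (δ : Config (Fin 2) Unit) (h : ℕ) (x : Fin 2) (hx : δ x = none) :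
    colorHeight (place (⊤ : SimpleGraph (Fin 2)) t δ ((), h) x 0) () +
      colorHeight (place (⊤ : SimpleGraph (Fin 2)) t δ ((), h) x 1) () =
    if t ≤ h + (colorHeight (δ 0) () + colorHeight (δ 1) ()) then 0
      else h + (colorHeight (δ 0) () + colorHeight (δ 1) ()) := by
  fin_cases x
  · have hx0 : δ 0 = none := hx
    have hn : neighborSum (⊤ : SimpleGraph (Fin 2)) δ () 0 = colorHeight (δ 1) () := by
      simp [neighborSum, Finset.sum_filter, Fin.sum_univ_two]
    rcases h1 : δ 1 with _ | ⟨c, k⟩ <;> rw [h1] at hn <;>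
      simp [place, hn, hx0, h1, colorHeight] <;> split_ifs <;> simp_all
  · have hx0 : δ 1 = none := hx
    have hn : neighborSum (⊤ : SimpleGraph (Fin 2)) δ () 1 = colorHeight (δ 0) () := by
      simp [neighborSum, Finset.sum_filter, Fin.sum_univ_two]
    rcases h1 : δ 0 with _ | ⟨c, k⟩ <;> rw [h1] at hn <;>
      simp [place, hn, hx0, h1, colorHeight] <;> split_ifs <;> simp_all

noncomputable def total (δ : Config (Fin 2) Unit) : ℕ :=
  colorHeight (δ 0) () + colorHeight (δ 1) ()

theorem total_place' (t : ℕ) (δ : Config (Fin 2) Unit) (h : ℕ) (x : Fin 2) (hx : δ x = none) :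
    total (place (⊤ : SimpleGraph (Fin 2)) t δ ((), h) x) =
      if t ≤ h + total δ then 0 else h + total δ := total_place t δ h x hx

theorem play_small (t : ℕ) (P : List ℕ) : ∀ (δ : Config (Fin 2) Unit) (p : List (Fin 2)),
    Legal (⊤ : SimpleGraph (Fin 2)) t δ (P.map (fun h => (((), h) : Unit × ℕ))) p →
    total δ + P.sum < t →
    total (play (⊤ : SimpleGraph (Fin 2)) t δ (P.map (fun h => (((), h) : Unit × ℕ))) p)
      = total δ + P.sum := by
  induction P with
  | nil => intro δ p _ _; simp [play]
  | cons a P ih =>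
    intro δ p hl hs
    rw [List.map_cons] at hl ⊢
    cases hl with
    | cons _ _ x p hx hl =>
      have h := total_place' t δ a x hx
      rw [List.sum_cons] at hs ⊢
      rw [if_neg (by omega)] at h
      rw [play, ih _ _ hl (by omega), h]
      omega

theorem play_main (t : ℕ) (P : List ℕ) : ∀ (δ : Config (Fin 2) Unit) (p : List (Fin 2)),
    Legal (⊤ : SimpleGraph (Fin 2)) t δ (P.map (fun h => (((), h) : Unit × ℕ))) p →
    total δ < t → total δ + P.sum = 2 * t → (∀ x ∈ P, x < t) →
    (∀ Q : List ℕ, Q <+: P → Q ≠ [] → total δ + Q.sum ≠ t) →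
    total (play (⊤ : SimpleGraph (Fin 2)) t δ (P.map (fun h => (((), h) : Unit × ℕ))) p)
      ≠ 0 := by
  induction P with
  | nil => intro δ p _ h1 h2; simp at h2; omega
  | cons a P ih =>
    intro δ p hl hd hs hlt hpre
    rw [List.map_cons] at hl ⊢
    cases hl with
    | cons _ _ x p hx hl =>
      have h := total_place' t δ a x hx
      rw [List.sum_cons] at hs
      have ha := hlt a (by simp)
      have hq := hpre [a] (by simp) (by simp)
      simp only [List.sum_cons, List.sum_nil] at hq
      rw [play]
      by_cases hc : t ≤ a + total δ
      · rw [if_pos hc] at h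
        rw [play_small t P _ _ hl (by omega), h]
        omega
      · rw [if_neg hc] at h
        refine ih _ _ hl (by omega) (by omega) (fun y hy => hlt y (by simp [hy])) ?_
        intro Q hQ _ he
        refine hpre (a :: Q) (by simpa using hQ) (by simp) ?_
        rw [List.sum_cons]
        omega

/-- on a single edge, a canonical-form Partition sequence cannot be emptied. -/
theorem statement_1 (P : List ℕ) (hP : P ≠ []) (hpos : ∀ x ∈ P, 0 < x)
    (heven : 2 ∣ P.sum)
    (hlt : ∀ x ∈ P, x < P.sum / 2)
    (hpre : ∀ Q : List ℕ, Q <+: P → Q ≠ [] → Q.sum ≠ P.sum / 2) :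
    ¬ Emptyable (⊤ : SimpleGraph (Fin 2)) (P.sum / 2)
        (P.map (fun h => (((), h) : Unit × ℕ))) := by
  rintro ⟨p, hl, he⟩
  have h0 : total (emptyConfig (Fin 2) Unit) = 0 := by simp [total, emptyConfig, colorHeight]
  obtain ⟨a, ha⟩ := List.exists_mem_of_ne_nil P hP
  have h1 := hlt a ha
  refine play_main _ P _ p hl (by omega) (by omega) hlt ?_ (by rw [he, h0])
  intro Q hQ hne
  rw [h0, zero_add]
  exact hpre Q hQ hne

end Hexasort
end

section
/- Let (G, S, t) be a Hexasort instance and let c be a color such that S contains exactly three stacks of color c, say (c, h_1), (c, h_2), (c, h_3) appearing in this order, where h_i < t for i = 1, 2, 3 and h_1 + h_2 ≥ t. Then in every placement of S that empties the board, the vertices on which the first and second color-c stacks are placed are non-adjacent and have a common neighbor w; the vertex w is empty at the moment the third color-c stack is placed, and the third color-c stack is placed on w (removing all three color-c stacks in one move). -/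
open scoped Classical

namespace Hexasort

/-- The color-`c` profile of a configuration. -/
noncomputable def prof {V C : Type*} (c : C) (δ : Config V C) : V → ℕ :=
  fun v => colorHeight (δ v) c

lemma prof_place_ne {V C : Type*} [Fintype V] (G : SimpleGraph V) (t : ℕ)
    (δ : Config V C) (s : C × ℕ) (x : V) (c : C) (hx : δ x = none) (hs : s.1 ≠ c) :
    prof c (place G t δ s x) = prof c δ := by
  funext v
  unfold prof place
  by_cases hv : v = x
  · subst hv
    rw [if_pos rfl, hx]
    split_ifs <;> simp [colorHeight, hs]
  · rw [if_neg hv]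
    split_ifs with h
    · obtain ⟨_, hh, e⟩ := h
      rw [e]; simp [colorHeight, hs]
    · rfl

lemma prof_place_self {V C : Type*} [Fintype V] (G : SimpleGraph V) (t : ℕ)
    (δ : Config V C) (h : ℕ) (x : V) (c : C) :
    prof c (place G t δ (c, h) x) x =
      if t ≤ h + neighborSum G δ c x then 0 else h + neighborSum G δ c x := by
  unfold prof place
  rw [if_pos rfl]
  split_ifs <;> simp [colorHeight]

lemma prof_place_adj {V C : Type*} [Fintype V] (G : SimpleGraph V) (t : ℕ)
    (δ : Config V C) (h : ℕ) (x v : V) (c : C) (hv : G.Adj x v) :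
    prof c (place G t δ (c, h) x) v = 0 := by
  unfold prof place
  rw [if_neg hv.ne']
  split_ifs with h
  · simp [colorHeight]
  · rcases e : δ v with _ | ⟨c', k⟩
    · simp [colorHeight]
    · by_cases hc : c' = c
      · subst hc; exact absurd ⟨hv, k, e⟩ h
      · simp [colorHeight, hc]

lemma prof_place_other {V C : Type*} [Fintype V] (G : SimpleGraph V) (t : ℕ)
    (δ : Config V C) (h : ℕ) (x v : V) (c : C) (hv : ¬ G.Adj x v) (hne : v ≠ x) :
    prof c (place G t δ (c, h) x) v = prof c δ v := by
  unfold prof place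
  simp [hv, hne]

lemma legal_length {V C : Type*} [Fintype V] {G : SimpleGraph V} {t : ℕ}
    {δ : Config V C} {S : List (C × ℕ)} {p : List V} (hl : Legal G t δ S p) :
    S.length = p.length := by
  induction hl with
  | nil => rfl
  | cons s S x p _ _ ih => simp [ih]

lemma legal_step {V C : Type*} [Fintype V] {G : SimpleGraph V} {t : ℕ}
    {δ : Config V C} {S : List (C × ℕ)} {p : List V} (hl : Legal G t δ S p) :
    ∀ (n : ℕ) (s : C × ℕ), S[n]? = some s → ∃ x, p[n]? = some x ∧
      play G t δ (S.take n) (p.take n) x = none ∧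
      play G t δ (S.take (n+1)) (p.take (n+1)) =
        place G t (play G t δ (S.take n) (p.take n)) s x := by
  induction hl with
  | nil => intro n s h; simp at h
  | cons s S x p h0 _ ih =>
    intro n s' h
    cases n with
    | zero =>
      simp at h
      subst h
      exact ⟨x, by simp, by simpa [play] using h0, by simp [play]⟩
    | succ n =>
      obtain ⟨y, a, b, d⟩ := ih n s' (by simpa using h)
      exact ⟨y, by simpa using a, by simpa [play] using b, by simpa [play] using d⟩

lemma prof_const {V C : Type*} [Fintype V] {G : SimpleGraph V} {t : ℕ}
    {δ : Config V C} {S : List (C × ℕ)} {p : List V} (hl : Legal G t δ S p) (c : C)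
    (a b : ℕ) (hab : a ≤ b) (hb : b ≤ S.length)
    (hno : ∀ j (hj : j < S.length), a ≤ j → j < b → (S[j]'hj).1 ≠ c) :
    prof c (play G t δ (S.take b) (p.take b)) = prof c (play G t δ (S.take a) (p.take a)) := by
  induction b, hab using Nat.le_induction with
  | base => rfl
  | succ b hab ih =>
    obtain ⟨x, _, h0, e⟩ := legal_step hl b _ (List.getElem?_eq_getElem (by omega))
    rw [e, prof_place_ne _ _ _ _ _ _ h0 (hno b (by omega) hab (by omega))]
    exact ih (by omega) fun j hj h1 h2 => hno j hj h1 (by omega)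

lemma ne_of_prof {V C : Type*} {δ : Config V C} {c : C} {x y : V} (h : δ x = none)
    (hy : prof c δ y ≠ 0) : y ≠ x := by
  rintro rfl
  exact hy (by simp [prof, h, colorHeight])

/-- Forced three-merge: if `S` contains exactly three color-`c` stacks,
each of height `< t`, with the first two summing to at least `t`, then in every
emptying placement the first two color-`c` stacks sit on non-adjacent vertices with a
common neighbor `w`, which is empty when the third color-`c` stack is placed on it. -/
theorem statement_2 {V C : Type*} [Fintype V] (G : SimpleGraph V) (t : ℕ)
    (ht : 1 ≤ t) (S : List (C × ℕ)) (hpos : ∀ s ∈ S, 1 ≤ s.2)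
    (c : C) (h1 h2 h3 : ℕ) (i1 i2 i3 : ℕ)
    (hi12 : i1 < i2) (hi23 : i2 < i3)
    (hs1 : S[i1]? = some (c, h1)) (hs2 : S[i2]? = some (c, h2))
    (hs3 : S[i3]? = some (c, h3))
    (honly : ∀ (j : ℕ) (hj : j < S.length), (S[j]'hj).1 = c → j = i1 ∨ j = i2 ∨ j = i3)
    (hh1 : h1 < t) (hh2 : h2 < t) (hh3 : h3 < t) (hsum : t ≤ h1 + h2)
    (p : List V)
    (hleg : Legal G t (emptyConfig V C) S p)
    (hemp : play G t (emptyConfig V C) S p = emptyConfig V C) :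
    ∃ u v w : V, p[i1]? = some u ∧ p[i2]? = some v ∧ p[i3]? = some w ∧
      u ≠ v ∧ ¬ G.Adj u v ∧ G.Adj u w ∧ G.Adj v w ∧
      play G t (emptyConfig V C) (S.take i3) (p.take i3) w = none := by
  have l1 : i1 < S.length := (List.getElem?_eq_some_iff.1 hs1).1
  have l2 : i2 < S.length := (List.getElem?_eq_some_iff.1 hs2).1
  have l3 : i3 < S.length := (List.getElem?_eq_some_iff.1 hs3).1
  have p1 : 1 ≤ h1 := hpos _ (List.mem_of_getElem? hs1)
  have p2 : 1 ≤ h2 := hpos _ (List.mem_of_getElem? hs2)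
  have p3 : 1 ≤ h3 := hpos _ (List.mem_of_getElem? hs3)
  obtain ⟨u, hu, u0, eu⟩ := legal_step hleg i1 _ hs1
  obtain ⟨v, hv, v0, ev⟩ := legal_step hleg i2 _ hs2
  obtain ⟨w, hw, w0, ew⟩ := legal_step hleg i3 _ hs3
  have c0 := prof_const hleg c 0 i1 (by omega) (by omega)
    (fun j hj _ _ e => by have := honly j hj e; omega)
  have c1 := prof_const hleg c (i1+1) i2 (by omega) (by omega)
    (fun j hj _ _ e => by have := honly j hj e; omega)
  have c2 := prof_const hleg c (i2+1) i3 (by omega) (by omega)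
    (fun j hj _ _ e => by have := honly j hj e; omega)
  have c3 := prof_const hleg c (i3+1) S.length (by omega) (by omega)
    (fun j hj _ _ e => by have := honly j hj e; omega)
  have hz : ∀ x, prof c (play G t (emptyConfig V C) (S.take (i3+1)) (p.take (i3+1))) x = 0 := by
    intro x
    rw [← c3, List.take_length, legal_length hleg, List.take_length, hemp]
    rfl
  rw [eu] at c1
  rw [ev] at c2
  rw [ew] at hz
  have hz0 : ∀ x, prof c (play G t (emptyConfig V C) (S.take i1) (p.take i1)) x = 0 := by
    intro x; rw [c0]; simp [play, prof, emptyConfig, colorHeight]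
  generalize play G t (emptyConfig V C) (S.take i1) (p.take i1) = δ1 at *
  generalize play G t (emptyConfig V C) (S.take i2) (p.take i2) = δ2 at *
  generalize play G t (emptyConfig V C) (S.take i3) (p.take i3) = δ3 at *
  have zsum : ∀ (δ : Config V C) x, (∀ y, G.Adj x y → prof c δ y = 0) → neighborSum G δ c x = 0 := by
    intro δ x h
    refine Finset.sum_eq_zero fun y hy => h y (by simpa using hy)
  have q1 : prof c δ2 u = h1 := by
    rw [c1, prof_place_self, zsum _ _ (fun y _ => hz0 y), if_neg (by omega)]; rfl
  have q1' : ∀ x, x ≠ u → prof c δ2 x = 0 := by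
    intro x hx
    rw [c1]
    by_cases ha : G.Adj u x
    · exact prof_place_adj _ _ _ _ _ _ _ ha
    · rw [prof_place_other _ _ _ _ _ _ _ ha hx, hz0]
  have huv : u ≠ v := ne_of_prof (c := c) v0 (by omega)
  have hna : ¬ G.Adj u v := by
    intro ha
    have hs : neighborSum G δ2 c v = h1 := by
      rw [← q1]
      refine Finset.sum_eq_single u (fun y _ hy => q1' y hy) (fun h => ?_)
      exact absurd (by simpa using ha.symm) h
    have z3 : ∀ x, prof c δ3 x = 0 := by
      intro x
      rw [c2]
      by_cases hx : x = v
      · subst hx; rw [prof_place_self, hs, if_pos (by omega)]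
      · by_cases hax : G.Adj v x
        · exact prof_place_adj _ _ _ _ _ _ _ hax
        · rw [prof_place_other _ _ _ _ _ _ _ hax hx]
          exact q1' x (fun e => hax (e ▸ ha.symm))
    have := hz w
    rw [prof_place_self, zsum _ _ (fun y _ => z3 y), if_neg (by omega)] at this
    omega
  have r1 : prof c δ3 u = h1 := by
    rw [c2, prof_place_other _ _ _ _ _ _ _ (fun h => hna h.symm) huv, q1]
  have r2 : prof c δ3 v = h2 := by
    rw [c2, prof_place_self, zsum, if_neg (by omega)]
    · rfl
    · intro y hy
      exact q1' y (fun e => hna (e ▸ hy.symm))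
  have key : ∀ x, prof c δ3 x ≠ 0 → G.Adj x w := by
    intro x hx
    by_contra ha
    have := hz x
    rw [prof_place_other _ _ _ _ _ _ _ (fun h => ha h.symm) (ne_of_prof w0 hx)] at this
    exact hx this
  exact ⟨u, v, w, hu, hv, hw, huv, hna, key u (by omega), key v (by omega), w0⟩

end Hexasort
end

section
/- Let (G, S, t) be a Hexasort instance and let c be a color such that S contains exactly four stacks of color c, in order (c, h_ℓ), (c, h_ℓ), (c, h_s), (c, h_s), where h_s < t/2 < h_ℓ and h_s + h_ℓ ≥ t. Then in every placement of S that empties the board, the four color-c stacks vanish either (a) via two independent merges, each merging one height-h_ℓ stack with one height-h_s stack, in which case the four stacks are placed on the endpoints of two vertex-disjoint edges of G; or (b) by merging all four stacks in a single move, in which case the first three are placed on three pairwise non-adjacent vertices that have a common neighbor, and the fourth is placed on that common neighbor (i.e., the four stacks are placed on a star with three leaves, the last on its center). -/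
open scoped Classical

namespace Hexasort

theorem legal_seq {V C : Type*} [Fintype V] (G : SimpleGraph V) (t : ℕ)
    {δ : Config V C} {S : List (C × ℕ)} {p : List V} (h : Legal G t δ S p) :
    ∃ D : ℕ → Config V C, D 0 = δ ∧ D S.length = play G t δ S p ∧
      ∀ k s, S[k]? = some s → ∃ x, p[k]? = some x ∧ D k x = none ∧
        D (k+1) = place G t (D k) s x := by
  induction h with
  | nil δ => exact ⟨fun _ => δ, rfl, rfl, by simp⟩
  | @cons δ s S x p hx hL ih =>
    obtain ⟨D, h0, hn, hs⟩ := ih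
    refine ⟨fun k => Nat.casesOn k δ D, rfl, ?_, ?_⟩
    · simpa [play] using hn
    · intro k s' hk
      cases k with
      | zero =>
        simp at hk
        subst hk
        exact ⟨x, by simp, hx, h0⟩
      | succ k =>
        simp at hk
        obtain ⟨y, hy, h1, h2⟩ := hs k s' hk
        exact ⟨y, by simpa using hy, h1, h2⟩

theorem place_same {V C : Type*} [Fintype V] (G : SimpleGraph V) (t : ℕ)
    (δ : Config V C) (c : C) (h : ℕ) (x v : V) :
    colorHeight (place G t δ (c, h) x v) c =
      if v = x then (if t ≤ h + neighborSum G δ c x then 0 else h + neighborSum G δ c x)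
      else if G.Adj x v then 0 else colorHeight (δ v) c := by
  unfold place
  by_cases h1 : v = x
  · simp only [h1, if_true]
    split_ifs <;> simp [colorHeight]
  · simp only [h1, if_false]
    by_cases h2 : G.Adj x v
    · simp only [h2, true_and, if_true]
      split_ifs with h3
      · simp [colorHeight]
      · rcases hd : δ v with _ | ⟨c', h'⟩
        · simp [colorHeight]
        · have : c' ≠ c := by
            rintro rfl
            exact h3 ⟨h', hd⟩
          simp [colorHeight, this]
    · simp [h2]

theorem place_diff {V C : Type*} [Fintype V] (G : SimpleGraph V) (t : ℕ)
    (δ : Config V C) (c : C) (s : C × ℕ) (x v : V) (hs : s.1 ≠ c) (hx : δ x = none) :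
    colorHeight (place G t δ s x v) c = colorHeight (δ v) c := by
  unfold place
  by_cases h1 : v = x
  · subst h1
    simp only [hx, if_true]
    split_ifs <;> simp [colorHeight, hs]
  · simp only [h1, if_false]
    split_ifs with h3
    · obtain ⟨_, h', hd⟩ := h3
      simp [colorHeight, hd, hs]
    · rfl

theorem const_of_steps {α : Type*} (F : ℕ → α) (a b : ℕ) (hab : a ≤ b)
    (h : ∀ k, a ≤ k → k < b → F (k+1) = F k) : F b = F a := by
  induction b, hab using Nat.le_induction with
  | base => rfl
  | succ n hn ih =>
    rw [h n hn (by omega)]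
    exact ih (fun k h1 h2 => h k h1 (by omega))

/-- Effect of one placement on the heights of one color. -/
noncomputable def cstep {V : Type*} [Fintype V] (G : SimpleGraph V) (t : ℕ)
    (f : V → ℕ) (h : ℕ) (x : V) : V → ℕ := fun v =>
  if v = x then (if t ≤ h + ∑ y ∈ Finset.univ.filter (fun y => G.Adj x y), f y then 0
    else h + ∑ y ∈ Finset.univ.filter (fun y => G.Adj x y), f y)
  else if G.Adj x v then 0 else f v

/-- Height function with three marked vertices. -/
noncomputable def tri {V : Type*} (u1 u2 u3 : V) (a b d : ℕ) : V → ℕ := fun v =>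
  (if v = u1 then a else 0) + (if v = u2 then b else 0) + (if v = u3 then d else 0)

theorem cstep_tri {V : Type*} [Fintype V] (G : SimpleGraph V) (t : ℕ)
    (u1 u2 u3 : V) (a b d h : ℕ) (x v : V) :
    cstep G t (tri u1 u2 u3 a b d) h x v =
     if v = x then (if t ≤ h + ((if G.Adj x u1 then a else 0) + (if G.Adj x u2 then b else 0)
        + (if G.Adj x u3 then d else 0)) then 0 else
        h + ((if G.Adj x u1 then a else 0) + (if G.Adj x u2 then b else 0)
        + (if G.Adj x u3 then d else 0)))
     else if G.Adj x v then 0 else tri u1 u2 u3 a b d v := by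
  have : ∑ y ∈ Finset.univ.filter (fun y => G.Adj x y), tri u1 u2 u3 a b d y =
      (if G.Adj x u1 then a else 0) + (if G.Adj x u2 then b else 0)
        + (if G.Adj x u3 then d else 0) := by
    simp [tri, Finset.sum_add_distrib, Finset.sum_ite_eq']
  unfold cstep
  rw [this]

theorem core {V : Type*} [Fintype V] (G : SimpleGraph V) (t hl hs : ℕ) (hs1 : 1 ≤ hs)
    (hhs : 2 * hs < t) (hhl : t < 2 * hl) (hsum : t ≤ hs + hl)
    (u1 u2 u3 u4 : V) (f1 f2 f3 f4 : V → ℕ)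
    (h1 : f1 = cstep G t (fun _ => 0) hl u1) (h2 : f2 = cstep G t f1 hl u2)
    (h3 : f3 = cstep G t f2 hs u3) (h4 : f4 = cstep G t f3 hs u4)
    (e2 : f1 u2 = 0) (e3 : f2 u3 = 0) (e4 : f3 u4 = 0) (hf : ∀ v, f4 v = 0) :
      ((G.Adj u1 u3 ∧ G.Adj u2 u4 ∧ u1 ≠ u2 ∧ u1 ≠ u4 ∧ u3 ≠ u2 ∧ u3 ≠ u4) ∨
       (G.Adj u1 u4 ∧ G.Adj u2 u3 ∧ u1 ≠ u2 ∧ u1 ≠ u3 ∧ u4 ≠ u2 ∧ u4 ≠ u3) ∨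
       (u1 ≠ u2 ∧ u1 ≠ u3 ∧ u2 ≠ u3 ∧
        ¬ G.Adj u1 u2 ∧ ¬ G.Adj u1 u3 ∧ ¬ G.Adj u2 u3 ∧
        G.Adj u1 u4 ∧ G.Adj u2 u4 ∧ G.Adj u3 u4)) := by
  have h0 : (fun _ : V => 0) = tri u1 u2 u3 0 0 0 := by funext v; simp [tri]
  rw [h0] at h1
  -- final contradiction from having at most hs left
  have fin : ∀ d, d ≤ hs → f3 = tri u1 u2 u3 0 0 d → False := by
    intro d hd h
    rw [h] at h4
    have := hf u4
    rw [h4, cstep_tri] at this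
    simp only [if_true] at this
    split_ifs at this <;> omega
  have fin2 : f2 = tri u1 u2 u3 0 0 0 → False := by
    intro h
    rw [h] at h3
    refine fin hs le_rfl ?_
    funext v
    rw [h3, cstep_tri]
    have : ¬ t ≤ hs := by omega
    by_cases hv : v = u3 <;> simp [tri, hv, this]
  by_cases hlt : t ≤ hl
  · exfalso
    have h1' : f1 = tri u1 u2 u3 0 0 0 := by
      funext v; rw [h1, cstep_tri]; simp [tri, hlt]
    apply fin2
    funext v; rw [h2, h1', cstep_tri]; simp [tri, hlt]
  have h1' : f1 = tri u1 u2 u3 hl 0 0 := by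
    funext v; rw [h1, cstep_tri]; by_cases hv : v = u1 <;> simp [tri, hv, hlt]
  have n12 : u1 ≠ u2 := by
    rintro rfl
    rw [h1'] at e2
    simp [tri] at e2
    omega
  rw [h1'] at h2
  by_cases a12 : G.Adj u2 u1
  · exfalso
    apply fin2
    funext v; rw [h2, cstep_tri]
    have : t ≤ hl + hl := by omega
    by_cases hv : v = u1
    · subst hv; simp [tri, a12, n12]
    · simp [tri, a12, this, hv]
  have h2' : f2 = tri u1 u2 u3 hl hl 0 := by
    funext v; rw [h2, cstep_tri]
    by_cases hv : v = u2
    · subst hv; simp [tri, a12, hlt, n12.symm]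
    · by_cases hw : v = u1
      · subst hw; simp [tri, a12, n12]
      · simp [tri, hv, hw]
  have n13 : u1 ≠ u3 := by
    rintro rfl
    rw [h2'] at e3
    simp [tri] at e3
    omega
  have n23 : u2 ≠ u3 := by
    rintro rfl
    rw [h2'] at e3
    simp [tri] at e3
    omega
  rw [h2'] at h3
  have a12' : ¬ G.Adj u1 u2 := fun h => a12 h.symm
  have hs0 : ¬ t ≤ hs := by omega
  by_cases a13 : G.Adj u3 u1 <;> by_cases a23 : G.Adj u3 u2
  · exfalso
    apply fin 0 (by omega)
    funext v; rw [h3, cstep_tri]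
    have : t ≤ hs + (hl + hl) := by omega
    by_cases hv : v = u1
    · subst hv; simp [tri, a13, n12, n13]
    · by_cases hw : v = u2
      · subst hw; simp [tri, a23, n23, n12.symm]
      · simp [tri, a13, a23, this, hv, hw]
  · have h3' : f3 = tri u1 u2 u3 0 hl 0 := by
      funext v; rw [h3, cstep_tri]
      by_cases hv : v = u1
      · subst hv; simp [tri, a13, n12, n13]
      · by_cases hw : v = u2
        · subst hw; simp [tri, a23, n23, n12.symm]
        · simp [tri, a13, a23, hsum, hv, hw]
    rw [h3'] at h4 e4
    have n24 : u4 ≠ u2 := by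
      rintro rfl
      simp [tri] at e4
      omega
    have a24 : G.Adj u4 u2 := by
      by_contra hc
      have := hf u2
      rw [h4, cstep_tri] at this
      simp [tri, hc, n24.symm] at this
      omega
    left
    refine ⟨a13.symm, a24.symm, n12, ?_, n23.symm, ?_⟩
    · rintro rfl; exact a12' a24
    · rintro rfl; exact a23 a24
  · have h3' : f3 = tri u1 u2 u3 hl 0 0 := by
      funext v; rw [h3, cstep_tri]
      by_cases hv : v = u1
      · subst hv; simp [tri, a13, n12, n13]
      · by_cases hw : v = u2
        · subst hw; simp [tri, a23, n23, n12.symm]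
        · simp [tri, a13, a23, hsum, hv, hw]
    rw [h3'] at h4 e4
    have n14 : u4 ≠ u1 := by
      rintro rfl
      simp [tri] at e4
      omega
    have a14 : G.Adj u4 u1 := by
      by_contra hc
      have := hf u1
      rw [h4, cstep_tri] at this
      simp [tri, hc, n14.symm] at this
      omega
    right; left
    refine ⟨a14.symm, a23.symm, n12, n13, ?_, ?_⟩
    · rintro rfl; exact a12 a14
    · rintro rfl; exact a13 a14
  · have h3' : f3 = tri u1 u2 u3 hl hl hs := by
      funext v; rw [h3, cstep_tri]
      by_cases hv : v = u1
      · subst hv; simp [tri, a13, n12, n13]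
      · by_cases hw : v = u2
        · subst hw; simp [tri, a23, n23, n12.symm]
        · by_cases hz : v = u3
          · subst hz; simp [tri, a13, a23, hs0, hv, hw]
          · simp [tri, hz, hv, hw]
    rw [h3'] at h4 e4
    have key : ∀ w, 0 < tri u1 u2 u3 hl hl hs w → G.Adj w u4 := by
      intro w hw
      by_contra hc
      have hc' : ¬ G.Adj u4 w := fun h => hc h.symm
      have hne : w ≠ u4 := by
        rintro rfl
        omega
      have := hf w
      rw [h4, cstep_tri, if_neg hne, if_neg hc'] at this
      omega
    right; right
    refine ⟨n12, n13, n23, a12', fun h => a13 h.symm, fun h => a23 h.symm,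
      key _ ?_, key _ ?_, key _ ?_⟩
    · simp [tri]; omega
    · simp [tri]; omega
    · simp [tri]; omega

/-- Forced four-merge: if `S` contains exactly four color-`c` stacks of
heights `hℓ, hℓ, hs, hs` (in this order) with `hs < t/2 < hℓ` and `hs + hℓ ≥ t`, then in
every emptying placement these four stacks are placed either (a) on the endpoints of two
vertex-disjoint edges, pairing each `hℓ`-stack with an `hs`-stack, or (b) on a star with
three leaves, the first three stacks on the pairwise non-adjacent leaves and the fourth
on the common center. -/
theorem statement_3 {V C : Type*} [Fintype V] (G : SimpleGraph V) (t : ℕ)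
    (ht : 1 ≤ t) (S : List (C × ℕ)) (hpos : ∀ s ∈ S, 1 ≤ s.2)
    (c : C) (hl hs : ℕ) (i1 i2 i3 i4 : ℕ)
    (hi12 : i1 < i2) (hi23 : i2 < i3) (hi34 : i3 < i4)
    (hst1 : S[i1]? = some (c, hl)) (hst2 : S[i2]? = some (c, hl))
    (hst3 : S[i3]? = some (c, hs)) (hst4 : S[i4]? = some (c, hs))
    (honly : ∀ (j : ℕ) (hj : j < S.length), (S[j]'hj).1 = c →
      j = i1 ∨ j = i2 ∨ j = i3 ∨ j = i4)
    (hhs : 2 * hs < t) (hhl : t < 2 * hl) (hsum : t ≤ hs + hl)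
    (p : List V)
    (hleg : Legal G t (emptyConfig V C) S p)
    (hemp : play G t (emptyConfig V C) S p = emptyConfig V C) :
    ∃ u1 u2 u3 u4 : V,
      p[i1]? = some u1 ∧ p[i2]? = some u2 ∧ p[i3]? = some u3 ∧ p[i4]? = some u4 ∧
      ((G.Adj u1 u3 ∧ G.Adj u2 u4 ∧ u1 ≠ u2 ∧ u1 ≠ u4 ∧ u3 ≠ u2 ∧ u3 ≠ u4) ∨
       (G.Adj u1 u4 ∧ G.Adj u2 u3 ∧ u1 ≠ u2 ∧ u1 ≠ u3 ∧ u4 ≠ u2 ∧ u4 ≠ u3) ∨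
       (u1 ≠ u2 ∧ u1 ≠ u3 ∧ u2 ≠ u3 ∧
        ¬ G.Adj u1 u2 ∧ ¬ G.Adj u1 u3 ∧ ¬ G.Adj u2 u3 ∧
        G.Adj u1 u4 ∧ G.Adj u2 u4 ∧ G.Adj u3 u4)) := by
  obtain ⟨D, hD0, hDn, hDs⟩ := legal_seq G t hleg
  obtain ⟨F, hF⟩ : ∃ F : ℕ → V → ℕ, ∀ k v, F k v = colorHeight (D k v) c := ⟨_, fun _ _ => rfl⟩
  have lt4 : i4 < S.length := (List.getElem?_eq_some_iff.mp hst4).1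
  have hskip : ∀ k, k < S.length → k ≠ i1 → k ≠ i2 → k ≠ i3 → k ≠ i4 → F (k+1) = F k := by
    intro k hk n1 n2 n3 n4
    obtain ⟨x, _, hx, hst⟩ := hDs k (S[k]'hk) (List.getElem?_eq_getElem hk)
    have hne : (S[k]'hk).1 ≠ c := by
      intro h
      have := honly k hk h
      omega
    funext v
    rw [hF, hF, hst, place_diff G t _ c _ x v hne hx]
  have hstep : ∀ k h, S[k]? = some (c, h) → ∃ x, p[k]? = some x ∧ F k x = 0 ∧
      F (k+1) = cstep G t (F k) h x := by
    intro k h hk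
    obtain ⟨x, hp, hx, hst⟩ := hDs k _ hk
    refine ⟨x, hp, by rw [hF, hx]; rfl, ?_⟩
    funext v
    rw [hF, hst, place_same]
    simp only [cstep, neighborSum, hF]
    congr!
  obtain ⟨u1, p1, _, s1⟩ := hstep i1 hl hst1
  obtain ⟨u2, p2, e2, s2⟩ := hstep i2 hl hst2
  obtain ⟨u3, p3, e3, s3⟩ := hstep i3 hs hst3
  obtain ⟨u4, p4, e4, s4⟩ := hstep i4 hs hst4
  have c1 : F i1 = F 0 := const_of_steps F 0 i1 (by omega) fun k _ _ =>
    hskip k (by omega) (by omega) (by omega) (by omega) (by omega)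
  have c2 : F i2 = F (i1+1) := const_of_steps F (i1+1) i2 (by omega) fun k _ _ =>
    hskip k (by omega) (by omega) (by omega) (by omega) (by omega)
  have c3 : F i3 = F (i2+1) := const_of_steps F (i2+1) i3 (by omega) fun k _ _ =>
    hskip k (by omega) (by omega) (by omega) (by omega) (by omega)
  have c4 : F i4 = F (i3+1) := const_of_steps F (i3+1) i4 (by omega) fun k _ _ =>
    hskip k (by omega) (by omega) (by omega) (by omega) (by omega)
  have c5 : F S.length = F (i4+1) := const_of_steps F (i4+1) S.length (by omega) fun k _ _ =>
    hskip k (by omega) (by omega) (by omega) (by omega) (by omega)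
  have z0 : F 0 = fun _ => 0 := by
    funext v; rw [hF, hD0]; rfl
  have hs1 : 1 ≤ hs := hpos (c, hs) (List.mem_of_getElem? hst3)
  refine ⟨u1, u2, u3, u4, p1, p2, p3, p4, ?_⟩
  rw [c1, z0] at s1
  rw [c2] at s2 e2
  rw [c3] at s3 e3
  rw [c4] at s4 e4
  refine core G t hl hs hs1 hhs hhl hsum u1 u2 u3 u4 _ _ _ _ s1 s2 s3 s4 e2 e3 e4 ?_
  intro v
  rw [← c5, hF, hDn, hemp]; rfl

end Hexasort
end

section
/- Let P = ⟨p_1, …, p_n⟩ be a sequence of positive integers whose total sum Σ is even, such that every p_i < Σ/2, no nonempty prefix of P sums to Σ/2, and t := Σ/2 ≥ 4. Let S = ⟨(black, p_1), …, (black, p_n)⟩ and S' = S_initial + S_reservation + S + S_connector. Then S' is emptyable on (G', t) if and only if there is a subset I ⊆ {1, …, n} with Σ_{i∈I} p_i = Σ/2. -/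
open scoped Classical

namespace Hexasort

/-- The vertices of the nine-vertex spider graph `G'`: a center `x`, two short-arm
leaves `s1, s2`, and three long arms `x – la i – lb i` for `i ∈ {0,1,2}`. -/
inductive SpiderV : Type
  | x | s1 | s2 | la : Fin 3 → SpiderV | lb : Fin 3 → SpiderV
  deriving DecidableEq, Fintype

/-- The nine-vertex spider graph `G'`. -/
def spiderG : SimpleGraph SpiderV :=
  SimpleGraph.fromRel (fun u v =>
    (u = .x ∧ v = .s1) ∨ (u = .x ∧ v = .s2) ∨
    (∃ i, u = .x ∧ v = .la i) ∨ (∃ i, u = .la i ∧ v = .lb i))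

/-- `S_initial = ⟨(red,t−1),(red,t−1),(blue,t−1),(blue,t−1)⟩`. -/
def Sinitial {C : Type*} (red blue : C) (t : ℕ) : List (C × ℕ) :=
  [(red, t-1), (red, t-1), (blue, t-1), (blue, t-1)]

/-- `S_reservation = ⟨(green,⌊t/2⌋+1),(green,⌊t/2⌋+1),(green,⌈t/2⌉−1),(green,⌈t/2⌉−1)⟩`. -/
def Sreservation {C : Type*} (green : C) (t : ℕ) : List (C × ℕ) :=
  [(green, t/2 + 1), (green, t/2 + 1), (green, (t+1)/2 - 1), (green, (t+1)/2 - 1)]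

/-- `S_connector = ⟨(red,t−1),(blue,t−1)⟩`. -/
def Sconnector {C : Type*} (red blue : C) (t : ℕ) : List (C × ℕ) :=
  [(red, t-1), (blue, t-1)]

end Hexasort

namespace Hexasort


def adjB : SpiderV → SpiderV → Bool
  | .x, .s1 => true
  | .x, .s2 => true
  | .x, .la _ => true
  | .s1, .x => true
  | .s2, .x => true
  | .la _, .x => true
  | .la i, .lb j => i == j
  | .lb i, .la j => i == j
  | _, _ => false

theorem adj_iff (u v : SpiderV) : spiderG.Adj u v ↔ adjB u v = true := by
  cases u <;> cases v <;> (simp [spiderG, adjB]; try first | done | exact eq_comm)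

theorem sum_spider (f : SpiderV → ℕ) : ∑ v, f v =
    f .x + f .s1 + f .s2 + (f (.la 0) + f (.la 1) + f (.la 2)) + (f (.lb 0) + f (.lb 1) + f (.lb 2)) := by
  have : (Finset.univ : Finset SpiderV) = {.x,.s1,.s2,.la 0,.la 1,.la 2,.lb 0,.lb 1,.lb 2} := by
    ext v
    cases v with
    | la i => fin_cases i <;> simp
    | lb i => fin_cases i <;> simp
    | _ => simp
  rw [this]
  repeat rw [Finset.sum_insert (by simp)]
  simp; ring

/-- single-color projection -/
noncomputable def pr {C : Type*} (c : C) (δ : Config SpiderV C) : SpiderV → ℕ :=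
  fun v => colorHeight (δ v) c

def ns (H : SpiderV → ℕ) (z : SpiderV) : ℕ := ∑ y, if adjB z y then H y else 0

def step (t : ℕ) (H : SpiderV → ℕ) (h : ℕ) (z : SpiderV) : SpiderV → ℕ := fun v =>
  if v = z then (if t ≤ h + ns H z then 0 else h + ns H z) else if adjB z v then 0 else H v

theorem neighborSum_eq {C : Type*} (δ : Config SpiderV C) (c : C) (z : SpiderV) :
    neighborSum spiderG δ c z = ns (pr c δ) z := by
  simp only [neighborSum, ns, pr, Finset.sum_filter, adj_iff]

theorem pr_same {C : Type*} (t : ℕ) (δ : Config SpiderV C) (c : C) (h : ℕ) (z : SpiderV) :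
    pr c (place spiderG t δ (c, h) z) = step t (pr c δ) h z := by
  funext v
  simp only [pr, place, step, neighborSum_eq, adj_iff]
  by_cases hv : v = z
  · simp only [hv, if_true]
    split_ifs <;> simp [colorHeight]
  · simp only [hv, if_false]
    by_cases ha : adjB z v = true
    · simp only [ha, true_and, if_true]
      split_ifs with h1
      · rfl
      · rcases hd : δ v with _ | ⟨c', h'⟩
        · rfl
        · simp only [colorHeight]
          rw [if_neg]
          rintro rfl
          exact h1 ⟨h', hd⟩
    · simp [ha]

theorem pr_other {C : Type*} (t : ℕ) (δ : Config SpiderV C) (c c' : C) (hc : c ≠ c') (h : ℕ)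
    (z : SpiderV) (hz : δ z = none) :
    pr c (place spiderG t δ (c', h) z) = pr c δ := by
  funext v
  simp only [pr, place]
  by_cases hv : v = z
  · subst hv
    simp only [if_true, hz]
    split_ifs <;> simp [colorHeight, hc.symm]
  · simp only [hv, if_false]
    split_ifs with h1
    · obtain ⟨_, hh, e⟩ := h1
      simp [e, colorHeight, hc.symm]
    · rfl

theorem pr_none {C : Type*} {δ : Config SpiderV C} {z : SpiderV} (hz : δ z = none) (c : C) :
    pr c δ z = 0 := by simp [pr, hz, colorHeight]

theorem pr_empty {C : Type*} (c : C) : pr c (emptyConfig SpiderV C) = 0 := rfl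

def Run {C : Type*} (t : ℕ) (δ : Config SpiderV C) (S : List (C × ℕ)) (δ' : Config SpiderV C) : Prop :=
  ∃ p, Legal spiderG t δ S p ∧ play spiderG t δ S p = δ'

theorem run_nil {C : Type*} {t : ℕ} {δ δ' : Config SpiderV C} : Run t δ [] δ' ↔ δ = δ' := by
  constructor
  · rintro ⟨p, h, e⟩
    cases h; simpa [play] using e
  · rintro rfl
    exact ⟨[], .nil _, rfl⟩

theorem run_cons {C : Type*} {t : ℕ} {δ δ' : Config SpiderV C} {s : C × ℕ} {S : List (C × ℕ)} :
    Run t δ (s :: S) δ' ↔ ∃ z, δ z = none ∧ Run t (place spiderG t δ s z) S δ' := by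
  constructor
  · rintro ⟨p, h, e⟩
    cases h with
    | cons _ _ z p hz hl => exact ⟨z, hz, p, hl, e⟩
  · rintro ⟨z, hz, p, hl, e⟩
    exact ⟨z :: p, .cons _ _ _ _ hz hl, e⟩

theorem run_append {C : Type*} {t : ℕ} {S T : List (C × ℕ)} {δ δ' : Config SpiderV C} :
    Run t δ (S ++ T) δ' ↔ ∃ m, Run t δ S m ∧ Run t m T δ' := by
  induction S generalizing δ with
  | nil => simp [run_nil]
  | cons s S ih =>
    simp only [List.cons_append, run_cons, ih]
    constructor
    · rintro ⟨z, hz, m, h1, h2⟩; exact ⟨m, ⟨z, hz, h1⟩, h2⟩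
    · rintro ⟨m, ⟨z, hz, h1⟩, h2⟩; exact ⟨z, hz, m, h1, h2⟩


def Reach (t : ℕ) : ℕ → ℕ → List ℕ → Prop
  | A, B, [] => A = 0 ∧ B = 0
  | A, B, p :: P => Reach t (if t ≤ p + A then 0 else p + A) B P ∨
      Reach t A (if t ≤ p + B then 0 else p + B) P

theorem reach_aux {t A B : ℕ} {P : List ℕ} (h : Reach t A B P) :
    A + B + P.sum = 0 ∨ t ≤ A + B + P.sum := by
  induction P generalizing A B with
  | nil => simp_all [Reach]
  | cons p P ih =>
    simp only [List.sum_cons]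
    rcases h with h | h <;> split_ifs at h with h1 <;> have := ih h <;> omega

theorem reach_sub {t A B : ℕ} {P : List ℕ} (h : Reach t A B P) (hA : A < t) (hB : B < t)
    (hP : ∀ p ∈ P, p < t) (hs : A + B + P.sum = 2 * t) : ∃ Q : List ℕ, Q.Sublist P ∧ A + Q.sum = t := by
  induction P generalizing A B with
  | nil => simp_all [Reach]
  | cons p P ih =>
    simp only [List.sum_cons] at hs
    have hp := hP p (by simp)
    have hP' : ∀ p ∈ P, p < t := fun q hq => hP q (by simp [hq])
    rcases h with h | h <;> split_ifs at h with h1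
    · have := reach_aux h
      exact ⟨[p], by simp, by simp; omega⟩
    · obtain ⟨Q, hQ, e⟩ := ih h (by omega) hB hP' (by omega)
      exact ⟨p :: Q, hQ.cons_cons _, by simp; omega⟩
    · have := reach_aux h
      exact ⟨P, by simp, by omega⟩
    · obtain ⟨Q, hQ, e⟩ := ih h hA (by omega) hP' (by omega)
      exact ⟨Q, hQ.cons _, e⟩

theorem reach_of {t A B : ℕ} {P Q : List ℕ} (hQ : Q.Sublist P) (hpos : ∀ p ∈ P, 0 < p)
    (h1 : Q.sum + A = t ∨ (A = 0 ∧ Q.sum = 0)) 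
    (h2 : P.sum + B = Q.sum + t ∨ (B = 0 ∧ P.sum = Q.sum)) (ht : 0 < t)
    (hA : A < t) (hB : B < t) : Reach t A B P := by
  induction hQ generalizing A B with
  | slnil => simp at h1 h2; exact ⟨by omega, by omega⟩
  | @cons Q P p hQ ih =>
    have hp := hpos p (by simp)
    have hle : Q.sum ≤ P.sum := hQ.sum_le_sum (by simp)
    simp only [List.sum_cons] at h2
    right
    refine ih (fun q hq => hpos q (by simp [hq])) h1 ?_ hA ?_ <;> split_ifs <;> omega
  | @cons_cons Q P p hQ ih =>
    have hp := hpos p (by simp)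
    have hle : Q.sum ≤ P.sum := hQ.sum_le_sum (by simp)
    simp only [List.sum_cons] at h1 h2
    left
    refine ih (fun q hq => hpos q (by simp [hq])) ?_ ?_ ?_ hB <;> (try split_ifs) <;> omega

theorem sub_fin (P : List ℕ) (t : ℕ) : (∃ I : Finset (Fin P.length), ∑ i ∈ I, P.get i = t) ↔
    ∃ Q : List ℕ, Q.Sublist P ∧ Q.sum = t := by
  constructor
  · rintro ⟨I, rfl⟩
    refine ⟨((List.finRange P.length).filter (· ∈ I)).map P.get, ?_, ?_⟩
    · have := (List.filter_sublist (p := (· ∈ I)) (l := List.finRange P.length)).map P.get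
      simpa using this
    · rw [← List.sum_toFinset]
      · congr 1
        ext; simp
      · exact (List.nodup_finRange _).filter _
  · rintro ⟨Q, hQ, rfl⟩
    obtain ⟨f, hf⟩ := List.sublist_iff_exists_fin_orderEmbedding_get_eq.1 hQ
    refine ⟨Finset.univ.map f.toEmbedding, ?_⟩
    rw [Finset.sum_map]
    simp only [RelEmbedding.coe_toEmbedding, ← hf]
    simp [Fin.sum_univ_def]
/-- indicator heights -/
def sg (u : SpiderV) (h : ℕ) : SpiderV → ℕ := fun v => if v = u then h else 0

theorem ns_add (H K : SpiderV → ℕ) (z : SpiderV) : ns (H + K) z = ns H z + ns K z := by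
  simp only [ns, ← Finset.sum_add_distrib]
  refine Finset.sum_congr rfl fun y _ => ?_
  split_ifs <;> simp

theorem ns_sg (u : SpiderV) (h : ℕ) (z : SpiderV) : ns (sg u h) z = if adjB z u then h else 0 := by
  simp only [ns, sg]
  rw [Finset.sum_eq_single u] <;> simp +contextual

theorem ns_zero (z : SpiderV) : ns 0 z = 0 := by simp [ns]

theorem adjB_symm (u v : SpiderV) : adjB u v = adjB v u := by
  cases u <;> cases v <;> simp [adjB, Bool.beq_comm]

theorem adjB_irrefl (u : SpiderV) : adjB u u = false := by
  cases u <;> simp [adjB]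

theorem step_zero {t h : ℕ} (hh : h < t) (u : SpiderV) : step t 0 h u = sg u h := by
  funext v
  simp [step, ns_zero, sg, not_le.2 hh]

/-- adjacent pair clears -/
theorem step_sg_adj {t h k : ℕ} {u z : SpiderV} (ha : adjB z u = true) (hk : t ≤ h + k) :
    step t (sg u k) h z = 0 := by
  funext v
  simp only [step, ns_sg, ha, if_true, hk, sg, Pi.zero_apply]
  split_ifs <;> simp_all

theorem step_nadj {t h : ℕ} {H : SpiderV → ℕ} {z : SpiderV} (hz : H z = 0) (hh : h < t)
    (ha : ∀ v, adjB z v = true → H v = 0) : step t H h z = H + sg z h := by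
  have : ns H z = 0 := by
    simp only [ns]; refine Finset.sum_eq_zero fun y _ => ?_
    split_ifs with h1
    · exact ha y h1
    · rfl
  funext v
  simp only [step, this, sg, Pi.add_apply]
  by_cases hv : v = z
  · subst hv; simp [hz, not_le.2 hh]
  · simp only [hv, if_false, add_zero]
    split_ifs with h1
    · exact (ha v h1).symm
    · rfl

theorem sg_self (u : SpiderV) (h : ℕ) : sg u h u = h := by simp [sg]

theorem sg_ne {u v : SpiderV} {h : ℕ} (hv : v ≠ u) : sg u h v = 0 := by simp [sg, hv]

theorem step_at {t h : ℕ} {H : SpiderV → ℕ} {z v : SpiderV} (hz : H z = 0) (hs : step t H h z = 0)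
    (hv : H v ≠ 0) : adjB z v = true := by
  have h1 := congrFun hs v
  by_contra ha
  have h2 : v ≠ z := by rintro rfl; exact hv hz
  simp only [step, if_neg ha, if_neg h2, Pi.zero_apply] at h1
  exact hv h1

theorem step_ns {t h : ℕ} {H : SpiderV → ℕ} {z : SpiderV} (hh : 0 < h) (hs : step t H h z = 0) :
    t ≤ h + ns H z := by
  have h1 := congrFun hs z
  simp only [step, if_true, Pi.zero_apply] at h1
  split_ifs at h1 with h2
  · exact h2
  · omega

theorem tri_s5 {t h : ℕ} (hh : h < t) (h0 : 0 < h) (h2 : t ≤ h + h) {u1 u2 r : SpiderV}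
    (e2 : sg u1 h u2 = 0) 
    (e3 : step t (sg u1 h) h u2 r = 0) (e4 : step t (step t (sg u1 h) h u2) h r = 0) :
    u2 ≠ u1 ∧ step t (sg u1 h) h u2 = sg u1 h + sg u2 h ∧ adjB r u1 = true ∧ adjB r u2 = true := by
  have hne : u2 ≠ u1 := by
    rintro rfl; rw [sg_self] at e2; omega
  by_cases ha : adjB u2 u1 = true
  · rw [step_sg_adj ha h2] at e4
    have := step_ns h0 e4
    rw [ns_zero] at this; omega
  have e5 : step t (sg u1 h) h u2 = sg u1 h + sg u2 h := by
    apply step_nadj e2 hh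
    intro v hv
    apply sg_ne; rintro rfl; exact ha hv
  rw [e5] at e3 e4
  refine ⟨hne, e5, step_at e3 e4 ?_, step_at e3 e4 ?_⟩
  · simp [sg_self]; omega
  · simp [sg_self]; omega

theorem green {t a b : ℕ} (hab : a + b = t) (haa : t ≤ a + a) (hbb : b + b < t) (hb : 0 < b)
    {g1 g2 g3 g4 : SpiderV}
    (e2 : sg g1 a g2 = 0) (e3 : step t (sg g1 a) a g2 g3 = 0)
    (e4 : step t (step t (sg g1 a) a g2) b g3 g4 = 0)
    (e5 : step t (step t (step t (sg g1 a) a g2) b g3) b g4 = 0) :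
    (g1 ≠ g2 ∧ adjB g1 g2 = false ∧ adjB g3 g1 = true ∧ adjB g3 g2 = false ∧ adjB g4 g2 = true) ∨
    (g1 ≠ g2 ∧ adjB g1 g2 = false ∧ adjB g3 g2 = true ∧ adjB g3 g1 = false ∧ adjB g4 g1 = true) ∨
    (g1 ≠ g2 ∧ g1 ≠ g3 ∧ g2 ≠ g3 ∧ adjB g4 g1 = true ∧ adjB g4 g2 = true ∧ adjB g4 g3 = true) := by
  have hne : g2 ≠ g1 := by
    rintro rfl; rw [sg_self] at e2; omega
  by_cases ha : adjB g2 g1 = true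
  · rw [step_sg_adj ha haa, step_zero (by omega)] at e5
    have := step_ns hb e5
    rw [ns_sg] at this; split_ifs at this <;> omega
  have e6 : step t (sg g1 a) a g2 = sg g1 a + sg g2 a := by
    apply step_nadj e2 (by omega)
    intro v hv
    apply sg_ne; rintro rfl; exact ha hv
  rw [e6] at e3 e4 e5
  have ha' : adjB g1 g2 = false := by rw [adjB_symm]; simpa using ha
  have h31 : g3 ≠ g1 := by
    rintro rfl; simp [sg_self] at e3; omega
  have h32 : g3 ≠ g2 := by
    rintro rfl; simp [sg_self] at e3; omega
  by_cases h1 : adjB g3 g1 = true <;> by_cases h2 : adjB g3 g2 = true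
  · have : step t (sg g1 a + sg g2 a) b g3 = 0 := by
      funext v
      simp only [step, ns_add, ns_sg, h1, h2, if_true, Pi.zero_apply, Pi.add_apply, sg]
      split_ifs <;> simp_all; omega
    rw [this] at e5
    have := step_ns hb e5
    rw [ns_zero] at this; omega
  · left
    have : step t (sg g1 a + sg g2 a) b g3 = sg g2 a := by
      funext v
      simp only [step, ns_add, ns_sg, h1, h2, if_true, Pi.add_apply, sg]
      split_ifs <;> simp_all; omega
    rw [this] at e4 e5
    exact ⟨hne.symm, ha', h1, by simpa using h2, step_at e4 e5 (by rw [sg_self]; omega)⟩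
  · right; left
    have : step t (sg g1 a + sg g2 a) b g3 = sg g1 a := by
      funext v
      simp only [step, ns_add, ns_sg, h1, h2, if_true, Pi.add_apply, sg]
      split_ifs <;> simp_all; omega
    rw [this] at e4 e5
    exact ⟨hne.symm, ha', h2, by simpa using h1, step_at e4 e5 (by rw [sg_self]; omega)⟩
  · right; right
    have : step t (sg g1 a + sg g2 a) b g3 = sg g1 a + sg g2 a + sg g3 b := by
      apply step_nadj e3 (by omega)
      intro v hv
      rw [Pi.add_apply, sg_ne, sg_ne]
      · rintro rfl; exact h2 hv
      · rintro rfl; exact h1 hv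
    rw [this] at e4 e5
    refine ⟨hne.symm, h31.symm, h32.symm, step_at e4 e5 ?_, step_at e4 e5 ?_, step_at e4 e5 ?_⟩ <;>
      simp [sg_self] <;> omega

theorem comb1 : ∀ r u1 u2 : SpiderV, adjB r u1 = true → adjB r u2 = true → u1 ≠ u2 →
    r = .x ∨ ∃ i, r = .la i ∧ ((u1 = .x ∧ u2 = .lb i) ∨ (u2 = .x ∧ u1 = .lb i)) := by
  decide
def fr (u1 u2 v1 v2 g : SpiderV) : Bool := g != u1 && g != u2 && g != v1 && g != v2

def verts : List SpiderV := [.x, .s1, .s2, .la 0, .la 1, .la 2, .lb 0, .lb 1, .lb 2]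

theorem mem_verts (v : SpiderV) : v ∈ verts := by
  cases v with
  | la i => fin_cases i <;> simp [verts]
  | lb i => fin_cases i <;> simp [verts]
  | _ => simp [verts]

/-- no green play in the free region -/
def noGreen (u1 u2 v1 v2 : SpiderV) : Bool :=
  let F := verts.filter (fr u1 u2 v1 v2)
  (F.all fun g1 => F.all fun g3 => !adjB g3 g1 || F.all fun g2 => adjB g1 g2 || adjB g3 g2 || g1 == g2 ||
      F.all fun g4 => !adjB g4 g2) &&
  (F.all fun g4 => F.all fun g1 => !adjB g4 g1 || F.all fun g2 => !adjB g4 g2 || g1 == g2 ||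
      F.all fun g3 => !adjB g4 g3 || g3 == g1 || g3 == g2)

theorem noGreen_spec {u1 u2 v1 v2 : SpiderV} (h : noGreen u1 u2 v1 v2 = true) {g1 g2 g3 g4 : SpiderV}
    (f1 : fr u1 u2 v1 v2 g1 = true) (f2 : fr u1 u2 v1 v2 g2 = true) (f3 : fr u1 u2 v1 v2 g3 = true)
    (f4 : fr u1 u2 v1 v2 g4 = true) :
    ¬ ((g1 ≠ g2 ∧ adjB g1 g2 = false ∧ adjB g3 g1 = true ∧ adjB g3 g2 = false ∧ adjB g4 g2 = true) ∨
    (g1 ≠ g2 ∧ adjB g1 g2 = false ∧ adjB g3 g2 = true ∧ adjB g3 g1 = false ∧ adjB g4 g1 = true) ∨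
    (g1 ≠ g2 ∧ g1 ≠ g3 ∧ g2 ≠ g3 ∧ adjB g4 g1 = true ∧ adjB g4 g2 = true ∧ adjB g4 g3 = true)) := by
  simp only [noGreen, Bool.and_eq_true, List.all_eq_true, Bool.or_eq_true, List.mem_filter, mem_verts,
    true_and, Bool.not_eq_true', beq_iff_eq] at h
  obtain ⟨h1, h2⟩ := h
  rintro (⟨a1, a2, a3, a4, a5⟩ | ⟨a1, a2, a3, a4, a5⟩ | ⟨a1, a2, a3, a4, a5, a6⟩)
  · have := h1 g1 f1 g3 f3
    simp only [a3, Bool.true_eq_false, false_or] at this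
    have := this g2 f2
    simp only [a1, a2, a4, Bool.false_eq_true, false_or] at this
    have := this g4 f4
    simp [a5] at this
  · have := h1 g2 f2 g3 f3
    simp only [a3, Bool.true_eq_false, false_or] at this
    have := this g1 f1
    simp only [a1.symm, adjB_symm g2 g1, a2, a4, Bool.false_eq_true, false_or] at this
    have := this g4 f4
    simp [a5] at this
  · have := h2 g4 f4 g1 f1
    simp only [a4, Bool.true_eq_false, false_or] at this
    have := this g2 f2
    simp only [a5, a1, Bool.true_eq_false, false_or] at this
    have := this g3 f3
    simp [a6, a2.symm, a3.symm] at this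

set_option maxRecDepth 100000 in
theorem combX : ∀ u1, adjB .x u1 = true → ∀ u2, adjB .x u2 = true → u1 ≠ u2 →
    ∀ v1, adjB .x v1 = true → v1 ≠ u1 → v1 ≠ u2 → ∀ v2, adjB .x v2 = true → v2 ≠ u1 → v2 ≠ u2 → v2 ≠ v1 →
    noGreen u1 u2 v1 v2 = true := by
  decide +kernel

set_option maxRecDepth 100000 in
theorem combL : ∀ i, ∀ v1, adjB .x v1 = true → v1 ≠ .la i → ∀ v2, adjB .x v2 = true → v2 ≠ .la i → v2 ≠ v1 →
    noGreen .x (.lb i) v1 v2 = true ∨ (v1 = .s1 ∧ v2 = .s2) ∨ (v1 = .s2 ∧ v2 = .s1) := by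
  decide +kernel

theorem noGreen_swap {u1 u2 v1 v2 : SpiderV} (h : noGreen u1 u2 v1 v2 = true) :
    noGreen u2 u1 v1 v2 = true := by
  have : fr u2 u1 v1 v2 = fr u1 u2 v1 v2 := by
    funext g; simp only [fr, Bool.and_comm (g != u2)]
  rw [noGreen, this]; exact h

theorem comb {r b u1 u2 v1 v2 g1 g2 g3 g4 : SpiderV}
    (hr1 : adjB r u1 = true) (hr2 : adjB r u2 = true) (hu : u1 ≠ u2)
    (hb1 : adjB b v1 = true) (hb2 : adjB b v2 = true) (hv : v2 ≠ v1)
    (h11 : v1 ≠ u1) (h12 : v1 ≠ u2) (h21 : v2 ≠ u1) (h22 : v2 ≠ u2) (hrv1 : r ≠ v1) (hrv2 : r ≠ v2)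
    (f1 : fr u1 u2 v1 v2 g1 = true) (f2 : fr u1 u2 v1 v2 g2 = true) (f3 : fr u1 u2 v1 v2 g3 = true)
    (f4 : fr u1 u2 v1 v2 g4 = true) 
    (hg : (g1 ≠ g2 ∧ adjB g1 g2 = false ∧ adjB g3 g1 = true ∧ adjB g3 g2 = false ∧ adjB g4 g2 = true) ∨
    (g1 ≠ g2 ∧ adjB g1 g2 = false ∧ adjB g3 g2 = true ∧ adjB g3 g1 = false ∧ adjB g4 g1 = true) ∨
    (g1 ≠ g2 ∧ g1 ≠ g3 ∧ g2 ≠ g3 ∧ adjB g4 g1 = true ∧ adjB g4 g2 = true ∧ adjB g4 g3 = true)) :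
    ∃ i, ((u1 = .x ∧ u2 = .lb i) ∨ (u2 = .x ∧ u1 = .lb i)) ∧
      ((v1 = .s1 ∧ v2 = .s2) ∨ (v1 = .s2 ∧ v2 = .s1)) := by
  have hno : noGreen u1 u2 v1 v2 ≠ true := fun h => noGreen_spec h f1 f2 f3 f4 hg
  rcases comb1 r u1 u2 hr1 hr2 hu with rfl | ⟨i, rfl, hi⟩
  · rcases comb1 b v1 v2 hb1 hb2 hv.symm with rfl | ⟨i, rfl, hi⟩
    · exact (hno (combX _ hr1 _ hr2 hu _ hb1 h11 h12 _ hb2 h21 h22 hv)).elim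
    · rcases hi with ⟨rfl, rfl⟩ | ⟨rfl, rfl⟩ <;> simp_all
  · have hbx : b = .x := by
      rcases comb1 b v1 v2 hb1 hb2 hv.symm with rfl | ⟨j, rfl, hj⟩
      · rfl
      · rcases hi with ⟨rfl, rfl⟩ | ⟨rfl, rfl⟩ <;> rcases hj with ⟨rfl, rfl⟩ | ⟨rfl, rfl⟩ <;> simp_all
    subst hbx
    refine ⟨i, hi, ?_⟩
    rcases combL i v1 hb1 hrv1.symm v2 hb2 hrv2.symm hv with h | h
    · exfalso
      rcases hi with ⟨rfl, rfl⟩ | ⟨rfl, rfl⟩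
      · exact hno h
      · exact hno (noGreen_swap h)
    · exact h
theorem ns_la (H : SpiderV → ℕ) (j : Fin 3) : ns H (.la j) = H .x + H (.lb j) := by
  rw [ns, sum_spider]; fin_cases j <;> simp [adjB]

theorem ns_lb (H : SpiderV → ℕ) (j : Fin 3) : ns H (.lb j) = H (.la j) := by
  rw [ns, sum_spider]; fin_cases j <;> simp [adjB]

/-- occupied by a red or a blue stack -/
def Bl {C : Type*} (red blue : C) (δ : Config SpiderV C) (v : SpiderV) : Prop :=
  pr red δ v ≠ 0 ∨ pr blue δ v ≠ 0

theorem Bl.ne {C : Type*} {red blue : C} {δ : Config SpiderV C} {v z : SpiderV} (h : Bl red blue δ v)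
    (hz : δ z = none) : z ≠ v := by
  rintro rfl
  rcases h with h | h <;> exact h (pr_none hz _)

theorem Bl.place {C : Type*} {red blue black : C} {δ : Config SpiderV C} {v z : SpiderV}
    (hkr : black ≠ red) (hkb : black ≠ blue) {t p : ℕ}
    (h : Bl red blue δ v) (hz : δ z = none) : Bl red blue (place spiderG t δ (black, p) z) v := by
  rwa [Bl, pr_other _ _ _ _ hkr.symm _ _ hz, pr_other _ _ _ _ hkb.symm _ _ hz]

theorem run_pr {C : Type*} {c black : C} (hc : c ≠ black) {t : ℕ} {P : List ℕ}
    {δ δ' : Config SpiderV C} (h : Run t δ (P.map (fun h => (black, h))) δ') : pr c δ' = pr c δ := by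
  induction P generalizing δ with
  | nil => rw [List.map_nil, run_nil] at h; rw [h]
  | cons p P ih =>
    rw [List.map_cons, run_cons] at h
    obtain ⟨z, hz, h⟩ := h
    rw [ih h, pr_other _ _ _ _ hc _ _ hz]

theorem stuck {C : Type*} {red blue black : C} (hkr : black ≠ red) (hkb : black ≠ blue) {t : ℕ}
    {P : List ℕ} {i : Fin 3} {δ δ' : Config SpiderV C}
    (h : Run t δ (P.map (fun h => (black, h))) δ')
    (hx : Bl red blue δ .x) (hl : Bl red blue δ (.lb i)) (hi : pr black δ (.la i) ≠ 0) :
    pr black δ' (.la i) ≠ 0 := by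
  induction P generalizing δ with
  | nil => rw [List.map_nil, run_nil] at h; rwa [← h]
  | cons p P ih =>
    rw [List.map_cons, run_cons] at h
    obtain ⟨z, hz, h⟩ := h
    refine ih h (hx.place hkr hkb hz) (hl.place hkr hkb hz) ?_
    have h1 := hx.ne hz
    have h2 := hl.ne hz
    have h3 : SpiderV.la i ≠ z := by rintro rfl; exact hi (pr_none hz _)
    have h4 : adjB z (.la i) = false := by
      cases z <;> simp_all [adjB]
    simpa [pr_same, step, h3, h4] using hi

theorem black_run {C : Type*} {red blue black : C} (hkr : black ≠ red) (hkb : black ≠ blue) {t : ℕ}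
    {P : List ℕ} {i j k : Fin 3} (hij : i ≠ j) (hik : i ≠ k) (hjk : j ≠ k)
    (hP : ∀ p ∈ P, 0 < p ∧ p < t)
    {δ δ' : Config SpiderV C} (h : Run t δ (P.map (fun h => (black, h))) δ')
    (hx : Bl red blue δ .x) (hl : Bl red blue δ (.lb i))
    (hs1 : Bl red blue δ .s1) (hs2 : Bl red blue δ .s2)
    (hbx : pr black δ .x = 0) (hbl : pr black δ (.lb i) = 0)
    (hj : pr black δ (.la j) = 0 ∨ pr black δ (.lb j) = 0)
    (hk : pr black δ (.la k) = 0 ∨ pr black δ (.lb k) = 0)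
    (hend : pr black δ' = 0) :
    Reach t (pr black δ (.la j) + pr black δ (.lb j)) (pr black δ (.la k) + pr black δ (.lb k)) P := by
  induction P generalizing δ with
  | nil =>
    rw [List.map_nil, run_nil] at h; subst h
    rw [hend]; exact ⟨rfl, rfl⟩
  | cons p P ih =>
    rw [List.map_cons, run_cons] at h
    obtain ⟨z, hz, h⟩ := h
    obtain ⟨hp0, hpt⟩ := hP p (by simp)
    have ih := ih (fun q hq => hP q (by simp [hq])) h (hx.place hkr hkb hz) (hl.place hkr hkb hz)
      (hs1.place hkr hkb hz) (hs2.place hkr hkb hz)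
    have n1 := hx.ne hz
    have n2 := hl.ne hz
    have n3 := hs1.ne hz
    have n4 := hs2.ne hz
    have hz0 := pr_none hz black
    have hm : ∀ m : Fin 3, m = i ∨ m = j ∨ m = k := by
      intro m; omega
    rw [pr_same] at ih
    cases z with
    | x => exact (n1 rfl).elim
    | s1 => exact (n3 rfl).elim
    | s2 => exact (n4 rfl).elim
    | la m =>
      rcases hm m with rfl | rfl | rfl
      · exfalso
        refine stuck hkr hkb h (hx.place hkr hkb hz) (hl.place hkr hkb hz) (i := m) ?_ (congrFun hend _)
        rw [pr_same]
        simp [step, ns_la, hbx, hbl]; omega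
      · left
        simpa [step, ns_la, adjB, hij, hij.symm, hjk, hjk.symm, hbx, hbl, hk, hz0] using ih
      · right
        simpa [step, ns_la, adjB, hik, hik.symm, hjk, hjk.symm, hbx, hbl, hj, hz0] using ih
    | lb m =>
      rcases hm m with rfl | rfl | rfl
      · exact (n2 rfl).elim
      · left
        simpa [step, ns_lb, adjB, hij, hij.symm, hjk, hjk.symm, hbx, hbl, hk, hz0] using ih
      · right
        simpa [step, ns_lb, adjB, hik, hik.symm, hjk, hjk.symm, hbx, hbl, hj, hz0] using ih

theorem forward {C : Type*} (red blue green' black : C)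
    (hrb : red ≠ blue) (hrg : red ≠ green') (hbg : blue ≠ green')
    (hkr : black ≠ red) (hkb : black ≠ blue) (hkg : black ≠ green')
    (P : List ℕ) (t : ℕ) (hP : ∀ p ∈ P, 0 < p ∧ p < t) (ht : 4 ≤ t)
    (h : Run t (emptyConfig SpiderV C) (Sinitial red blue t ++ Sreservation green' t ++
          P.map (fun h => (black, h)) ++ Sconnector red blue t) (emptyConfig SpiderV C)) :
    Reach t 0 0 P := by
  rw [run_append] at h
  obtain ⟨δ9, h, hc⟩ := h
  rw [run_append] at h
  obtain ⟨δ8, h, hb⟩ := h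
  simp only [Sinitial, Sreservation, Sconnector, List.cons_append, List.nil_append, run_cons, run_nil] at h hc
  obtain ⟨u1, -, u2, hu2, v1, hv1, v2, hv2, g1, hg1, g2, hg2, g3, hg3, g4, hg4, e8⟩ := h
  obtain ⟨r, hr, b, hb', e11⟩ := hc
  -- projections
  have R1 := pr_same t (emptyConfig SpiderV C) red (t-1) u1
  set δ1 := place spiderG t (emptyConfig SpiderV C) (red, t-1) u1 with hδ1
  have B1 : pr blue δ1 = 0 := pr_other _ _ _ _ hrb.symm _ _ rfl
  have G1 : pr green' δ1 = 0 := pr_other _ _ _ _ hrg.symm _ _ rfl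
  have K1 : pr black δ1 = 0 := pr_other _ _ _ _ hkr _ _ rfl
  clear_value δ1
  rw [pr_empty, step_zero (by omega)] at R1
  have R2 := pr_same t δ1 red (t-1) u2
  have B2 := pr_other t δ1 _ _ hrb.symm (t-1) _ hu2
  have G2 := pr_other t δ1 _ _ hrg.symm (t-1) _ hu2
  have K2 := pr_other t δ1 _ _ hkr (t-1) _ hu2
  generalize place spiderG t δ1 (red, t-1) u2 = δ2 at *
  have R3 := pr_other t δ2 _ _ hrb (t-1) _ hv1
  have B3 := pr_same t δ2 blue (t-1) v1
  have G3 := pr_other t δ2 _ _ hbg.symm (t-1) _ hv1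
  have K3 := pr_other t δ2 _ _ hkb (t-1) _ hv1
  generalize place spiderG t δ2 (blue, t-1) v1 = δ3 at *
  have R4 := pr_other t δ3 _ _ hrb (t-1) _ hv2
  have B4 := pr_same t δ3 blue (t-1) v2
  have G4 := pr_other t δ3 _ _ hbg.symm (t-1) _ hv2
  have K4 := pr_other t δ3 _ _ hkb (t-1) _ hv2
  generalize place spiderG t δ3 (blue, t-1) v2 = δ4 at *
  have R5 := pr_other t δ4 _ _ hrg (t/2+1) _ hg1
  have B5 := pr_other t δ4 _ _ hbg (t/2+1) _ hg1
  have G5 := pr_same t δ4 green' (t/2+1) g1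
  have K5 := pr_other t δ4 _ _ hkg (t/2+1) _ hg1
  generalize place spiderG t δ4 (green', t/2+1) g1 = δ5 at *
  have R6 := pr_other t δ5 _ _ hrg (t/2+1) _ hg2
  have B6 := pr_other t δ5 _ _ hbg (t/2+1) _ hg2
  have G6 := pr_same t δ5 green' (t/2+1) g2
  have K6 := pr_other t δ5 _ _ hkg (t/2+1) _ hg2
  generalize place spiderG t δ5 (green', t/2+1) g2 = δ6 at *
  have R7 := pr_other t δ6 _ _ hrg ((t+1)/2-1) _ hg3
  have B7 := pr_other t δ6 _ _ hbg ((t+1)/2-1) _ hg3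
  have G7 := pr_same t δ6 green' ((t+1)/2-1) g3
  have K7 := pr_other t δ6 _ _ hkg ((t+1)/2-1) _ hg3
  generalize place spiderG t δ6 (green', (t+1)/2-1) g3 = δ7 at *
  have R8 := pr_other t δ7 _ _ hrg ((t+1)/2-1) _ hg4
  have B8 := pr_other t δ7 _ _ hbg ((t+1)/2-1) _ hg4
  have G8 := pr_same t δ7 green' ((t+1)/2-1) g4
  have K8 := pr_other t δ7 _ _ hkg ((t+1)/2-1) _ hg4
  rw [e8] at R8 B8 G8 K8
  clear e8
  have R9 := run_pr hkr.symm hb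
  have B9 := run_pr hkb.symm hb
  have G9 := run_pr hkg.symm hb
  have R10 := pr_same t δ9 red (t-1) r
  have B10 := pr_other t δ9 _ _ hrb.symm (t-1) _ hr
  have G10 := pr_other t δ9 _ _ hrg.symm (t-1) _ hr
  have K10 := pr_other t δ9 _ _ hkr (t-1) _ hr
  generalize place spiderG t δ9 (red, t-1) r = δ10 at *
  have R11 := pr_other t δ10 _ _ hrb (t-1) _ hb'
  have B11 := pr_same t δ10 blue (t-1) b
  have G11 := pr_other t δ10 _ _ hbg.symm (t-1) _ hb'
  have K11 := pr_other t δ10 _ _ hkb (t-1) _ hb'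
  rw [e11, pr_empty] at R11 B11 G11 K11
  clear e11
  -- analysis
  have zu2 := pr_none hu2 red
  have zr := pr_none hr red
  rw [R9, R8, R7, R6, R5, R4, R3, R2, R1] at zr
  rw [R10, R9, R8, R7, R6, R5, R4, R3, R2, R1] at R11
  rw [R1] at zu2
  obtain ⟨hu, RR, ar1, ar2⟩ := tri_s5 (by omega) (by omega) (by omega) zu2 zr R11.symm
  rw [B2, B1, step_zero (by omega)] at B3
  have zv2 := pr_none hv2 blue
  have zb := pr_none hb' blue
  rw [B10, B9, B8, B7, B6, B5, B4, B3] at zb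
  rw [B10, B9, B8, B7, B6, B5, B4, B3] at B11
  rw [B3] at zv2
  obtain ⟨hv, BB, ab1, ab2⟩ := tri_s5 (by omega) (by omega) (by omega) zv2 zb B11.symm
  rw [G4, G3, G2, G1, step_zero (by omega)] at G5
  have zg2 := pr_none hg2 green'
  have zg3 := pr_none hg3 green'
  have zg4 := pr_none hg4 green'
  rw [G5] at zg2
  rw [G6, G5] at zg3
  rw [G7, G6, G5] at zg4
  rw [G10, G9, G8, G7, G6, G5] at G11
  have GG := green (by omega) (by omega) (by omega) (by omega) zg2 zg3 zg4 G11.symm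
  have R2' : pr red δ2 = sg u1 (t-1) + sg u2 (t-1) := by rw [R2, R1, RR]
  have B4' : pr blue δ4 = sg v1 (t-1) + sg v2 (t-1) := by rw [B4, B3, BB]
  have keyR : ∀ {δ : Config SpiderV C} {z : SpiderV}, pr red δ = sg u1 (t-1) + sg u2 (t-1) →
      δ z = none → z ≠ u1 ∧ z ≠ u2 := by
    intro δ z e hz
    have := pr_none hz red
    rw [e] at this
    constructor <;> rintro rfl <;> simp [sg_self] at this <;> omega
  have keyB : ∀ {δ : Config SpiderV C} {z : SpiderV}, pr blue δ = sg v1 (t-1) + sg v2 (t-1) →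
      δ z = none → z ≠ v1 ∧ z ≠ v2 := by
    intro δ z e hz
    have := pr_none hz blue
    rw [e] at this
    constructor <;> rintro rfl <;> simp [sg_self] at this <;> omega
  rw [R2'] at R3; rw [R3] at R4; rw [R4] at R5; rw [R5] at R6; rw [R6] at R7; rw [R7] at R8
  rw [B4'] at B5; rw [B5] at B6; rw [B6] at B7; rw [B7] at B8; rw [B8] at B9
  have fr' : ∀ {δ : Config SpiderV C} {z : SpiderV}, pr red δ = sg u1 (t-1) + sg u2 (t-1) →
      pr blue δ = sg v1 (t-1) + sg v2 (t-1) → δ z = none → fr u1 u2 v1 v2 z = true := by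
    intro δ z e1 e2 hz
    obtain ⟨a, b⟩ := keyR e1 hz
    obtain ⟨c, d⟩ := keyB e2 hz
    simp [fr, a, b, c, d]
  obtain ⟨i, hU, hV⟩ := comb ar1 ar2 hu.symm ab1 ab2 hv (keyR R2' hv1).1 (keyR R2' hv1).2
    (keyR R3 hv2).1 (keyR R3 hv2).2 (keyB B9 hr).1 (keyB B9 hr).2
    (fr' R4 B4' hg1) (fr' R5 B5 hg2) (fr' R6 B6 hg3) (fr' R7 B7 hg4) GG
  have blU : ∀ v, v = u1 ∨ v = u2 → Bl red blue δ8 v := by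
    intro v hv; left; rw [R8]
    rcases hv with rfl | rfl <;> simp [sg_self] <;> omega
  have blV : ∀ v, v = v1 ∨ v = v2 → Bl red blue δ8 v := by
    intro v hv; right; rw [B8]
    rcases hv with rfl | rfl <;> simp [sg_self] <;> omega
  have K8' : pr black δ8 = 0 := by rw [K8, K7, K6, K5, K4, K3, K2, K1]
  have K9 : pr black δ9 = 0 := by rw [← K10, ← K11]
  have hjk : ∀ i : Fin 3, ∃ j k, i ≠ j ∧ i ≠ k ∧ j ≠ k := by decide
  obtain ⟨j, k, hij, hik, hjk⟩ := hjk i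
  have := black_run hkr hkb hij hik hjk hP hb
    (blU _ (by rcases hU with ⟨h1, h2⟩ | ⟨h1, h2⟩ <;> simp [h1, h2]))
    (blU _ (by rcases hU with ⟨h1, h2⟩ | ⟨h1, h2⟩ <;> simp [h1, h2]))
    (blV _ (by rcases hV with ⟨h1, h2⟩ | ⟨h1, h2⟩ <;> simp [h1, h2]))
    (blV _ (by rcases hV with ⟨h1, h2⟩ | ⟨h1, h2⟩ <;> simp [h1, h2]))
    (by rw [K8']; rfl) (by rw [K8']; rfl) (by rw [K8']; left; rfl) (by rw [K8']; left; rfl) K9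
  rw [K8'] at this
  exact this
/-- explicit configuration -/
def mk {C : Type*} (x s1 s2 a0 a1 a2 b0 b1 b2 : Option (C × ℕ)) : Config SpiderV C
  | .x => x
  | .s1 => s1
  | .s2 => s2
  | .la 0 => a0
  | .la 1 => a1
  | .la 2 => a2
  | .lb 0 => b0
  | .lb 1 => b1
  | .lb 2 => b2

theorem mk_ext {C : Type*} (δ : Config SpiderV C) : δ = mk (δ .x) (δ .s1) (δ .s2) (δ (.la 0)) (δ (.la 1))
    (δ (.la 2)) (δ (.lb 0)) (δ (.lb 1)) (δ (.lb 2)) := by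
  funext v
  cases v with
  | la i => fin_cases i <;> rfl
  | lb i => fin_cases i <;> rfl
  | _ => rfl

def EL {C : Type*} (black : C) (e f : Option (C × ℕ)) (A : ℕ) : Prop :=
  (e = none ∧ f = none ∧ A = 0) ∨ (e = some (black, A) ∧ f = none) ∨ (e = none ∧ f = some (black, A))

set_option maxHeartbeats 2000000 in
theorem back_black {C : Type*} {red blue black : C} (hkr : black ≠ red) (hkb : black ≠ blue) {t h : ℕ}
    (P : List ℕ) (hP : ∀ p ∈ P, 0 < p) (A B : ℕ) (e1 f1 e2 f2 : Option (C × ℕ))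
    (h1 : EL black e1 f1 A) (h2 : EL black e2 f2 B) (hA : e1 ≠ none ∨ f1 ≠ none → 0 < A)
    (hB : e2 ≠ none ∨ f2 ≠ none → 0 < B) (hR : Reach t A B P) :
    Run t (mk (some (red, h)) (some (blue, h)) (some (blue, h)) none e1 e2 (some (red, h)) f1 f2)
      (P.map (fun h => (black, h)))
      (mk (some (red, h)) (some (blue, h)) (some (blue, h)) none none none (some (red, h)) none none) := by
  induction P generalizing A B e1 f1 e2 f2 with
  | nil =>
    obtain ⟨rfl, rfl⟩ := hR
    rw [List.map_nil, run_nil]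
    rcases h1 with ⟨rfl, rfl, -⟩ | ⟨rfl, rfl⟩ | ⟨rfl, rfl⟩ <;>
    rcases h2 with ⟨rfl, rfl, -⟩ | ⟨rfl, rfl⟩ | ⟨rfl, rfl⟩ <;> simp_all
  | cons p P ih =>
    have hp := hP p (by simp)
    have ih := ih (fun q hq => hP q (by simp [hq]))
    rw [List.map_cons, run_cons]
    rcases hR with hR | hR
    · by_cases he : e1 = none
      · refine ⟨.la 1, by simpa [mk] using he, ?_⟩
        have : place spiderG t (mk (some (red, h)) (some (blue, h)) (some (blue, h)) none e1 e2 (some (red, h)) f1 f2) (black, p) (.la 1)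
          = mk (some (red, h)) (some (blue, h)) (some (blue, h)) none (if t ≤ p + A then none else some (black, p + A)) e2 (some (red, h)) none f2 := by
          rw [mk_ext (place _ _ _ _ _)]
          rcases h1 with ⟨rfl, rfl, rfl⟩ | ⟨rfl, rfl⟩ | ⟨rfl, rfl⟩ <;>
            simp_all [mk, place, neighborSum_eq, ns_la, adj_iff, adjB, pr, colorHeight, hkr.symm]
        rw [this]
        refine ih _ B _ _ _ _ ?_ h2 ?_ hB hR
        · split_ifs <;> simp [EL]
        · split_ifs <;> simp; omega
      · have hf : f1 = none := by
          rcases h1 with ⟨rfl, rfl, -⟩ | ⟨rfl, rfl⟩ | ⟨rfl, rfl⟩ <;> simp_all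
        refine ⟨.lb 1, by simpa [mk] using hf, ?_⟩
        have : place spiderG t (mk (some (red, h)) (some (blue, h)) (some (blue, h)) none e1 e2 (some (red, h)) f1 f2) (black, p) (.lb 1)
          = mk (some (red, h)) (some (blue, h)) (some (blue, h)) none none e2 (some (red, h)) (if t ≤ p + A then none else some (black, p + A)) f2 := by
          rw [mk_ext (place _ _ _ _ _)]
          rcases h1 with ⟨rfl, rfl, rfl⟩ | ⟨rfl, rfl⟩ | ⟨rfl, rfl⟩ <;>
            simp_all [mk, place, neighborSum_eq, ns_lb, adj_iff, adjB, pr, colorHeight]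
        rw [this]
        refine ih _ B _ _ _ _ ?_ h2 ?_ hB hR
        · split_ifs <;> simp [EL]
        · split_ifs <;> simp; omega
    · by_cases he : e2 = none
      · refine ⟨.la 2, by simpa [mk] using he, ?_⟩
        have : place spiderG t (mk (some (red, h)) (some (blue, h)) (some (blue, h)) none e1 e2 (some (red, h)) f1 f2) (black, p) (.la 2)
          = mk (some (red, h)) (some (blue, h)) (some (blue, h)) none e1 (if t ≤ p + B then none else some (black, p + B)) (some (red, h)) f1 none := by
          rw [mk_ext (place _ _ _ _ _)]
          rcases h2 with ⟨rfl, rfl, rfl⟩ | ⟨rfl, rfl⟩ | ⟨rfl, rfl⟩ <;>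
            simp_all [mk, place, neighborSum_eq, ns_la, adj_iff, adjB, pr, colorHeight, hkr.symm]
        rw [this]
        refine ih A _ _ _ _ _ h1 ?_ hA ?_ hR
        · split_ifs <;> simp [EL]
        · split_ifs <;> simp; omega
      · have hf : f2 = none := by
          rcases h2 with ⟨rfl, rfl, -⟩ | ⟨rfl, rfl⟩ | ⟨rfl, rfl⟩ <;> simp_all
        refine ⟨.lb 2, by simpa [mk] using hf, ?_⟩
        have : place spiderG t (mk (some (red, h)) (some (blue, h)) (some (blue, h)) none e1 e2 (some (red, h)) f1 f2) (black, p) (.lb 2)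
          = mk (some (red, h)) (some (blue, h)) (some (blue, h)) none e1 none (some (red, h)) f1 (if t ≤ p + B then none else some (black, p + B)) := by
          rw [mk_ext (place _ _ _ _ _)]
          rcases h2 with ⟨rfl, rfl, rfl⟩ | ⟨rfl, rfl⟩ | ⟨rfl, rfl⟩ <;>
            simp_all [mk, place, neighborSum_eq, ns_lb, adj_iff, adjB, pr, colorHeight]
        rw [this]
        refine ih A _ _ _ _ _ h1 ?_ hA ?_ hR
        · split_ifs <;> simp [EL]
        · split_ifs <;> simp; omega

theorem ns_x (H : SpiderV → ℕ) : ns H .x = H .s1 + H .s2 + (H (.la 0) + H (.la 1) + H (.la 2)) := by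
  rw [ns, sum_spider]; simp [adjB]

theorem ns_s1 (H : SpiderV → ℕ) : ns H .s1 = H .x := by
  rw [ns, sum_spider]; simp [adjB]

theorem ns_s2 (H : SpiderV → ℕ) : ns H .s2 = H .x := by
  rw [ns, sum_spider]; simp [adjB]

theorem run_step {C : Type*} {t : ℕ} {δ δ1 δ' : Config SpiderV C} {s : C × ℕ} {S : List (C × ℕ)}
    (z : SpiderV) (hz : δ z = none) (e : place spiderG t δ s z = δ1) (h : Run t δ1 S δ') :
    Run t δ (s :: S) δ' := run_cons.2 ⟨z, hz, e ▸ h⟩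

theorem backward {C : Type*} (red blue green' black : C)
    (hrb : red ≠ blue) (hrg : red ≠ green') (hbg : blue ≠ green')
    (hkr : black ≠ red) (hkb : black ≠ blue)
    (P : List ℕ) (t : ℕ) (hP : ∀ p ∈ P, 0 < p) (ht : 4 ≤ t) (hR : Reach t 0 0 P) :
    Run t (emptyConfig SpiderV C) (Sinitial red blue t ++ Sreservation green' t ++
          P.map (fun h => (black, h)) ++ Sconnector red blue t) (emptyConfig SpiderV C) := by
  have e0 : emptyConfig SpiderV C = mk none none none none none none none none none := mk_ext _
  have i1 : ¬ t ≤ t - 1 := by omega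
  have i2 : t ≤ t - 1 + (t - 1) := by omega
  have i3 : ¬ t ≤ t / 2 + 1 := by omega
  have i4 : t ≤ (t + 1) / 2 - 1 + (t / 2 + 1) := by omega
  have i5 : t ≤ t - 1 + (t - 1 + (t - 1)) := by omega
  rw [run_append]
  refine ⟨mk (some (red, t-1)) (some (blue, t-1)) (some (blue, t-1)) none none none (some (red, t-1)) none none, ?_, ?_⟩
  · rw [run_append]
    refine ⟨mk (some (red, t-1)) (some (blue, t-1)) (some (blue, t-1)) none none none (some (red, t-1)) none none, ?_, ?_⟩
    · rw [e0]
      simp only [Sinitial, Sreservation, List.cons_append, List.nil_append]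
      refine run_step .x rfl (mk_ext _) (run_step (.lb 0) ?_ (mk_ext _) (run_step .s1 ?_ (mk_ext _)
        (run_step .s2 ?_ (mk_ext _) (run_step (.la 1) ?_ (mk_ext _) (run_step (.la 2) ?_ (mk_ext _)
        (run_step (.lb 1) ?_ (mk_ext _) (run_step (.lb 2) ?_ (mk_ext _) (run_nil.2 ?_)))))))) <;>
      simp [mk, place, neighborSum_eq, ns_x, ns_s1, ns_s2, ns_la, ns_lb, adj_iff, adjB, pr, colorHeight, *,
        hrb.symm, hrg.symm, hbg.symm]
    · exact back_black hkr hkb P hP 0 0 _ _ _ _ (by simp [EL]) (by simp [EL]) (by simp) (by simp) hR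
  · rw [e0]
    simp only [Sconnector]
    refine run_step (.la 0) rfl (mk_ext _) (run_step .x ?_ (mk_ext _) (run_nil.2 ?_)) <;>
      simp [mk, place, neighborSum_eq, ns_x, ns_s1, ns_s2, ns_la, ns_lb, adj_iff, adjB, pr, colorHeight, *,
        hrb.symm, hrg.symm, hbg.symm]

/-- reduction from Partition to Empty Hexasort on the nine-vertex spider:
`S' = S_initial + S_reservation + S + S_connector` is emptyable on `(G', Σ/2)` iff the
Partition instance `P` has a solution. -/
theorem statement_5 {C : Type*} (red blue green black : C)
    (hrb : red ≠ blue) (hrg : red ≠ green) (hbg : blue ≠ green)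
    (hkr : black ≠ red) (hkb : black ≠ blue) (hkg : black ≠ green)
    (P : List ℕ) (hpos : ∀ x ∈ P, 0 < x)
    (heven : 2 ∣ P.sum)
    (hlt : ∀ x ∈ P, x < P.sum / 2)
    (hpre : ∀ Q : List ℕ, Q <+: P → Q ≠ [] → Q.sum ≠ P.sum / 2)
    (ht : 4 ≤ P.sum / 2) :
    Emptyable spiderG (P.sum / 2)
        (Sinitial red blue (P.sum / 2) ++ Sreservation green (P.sum / 2) ++
          P.map (fun h => (black, h)) ++ Sconnector red blue (P.sum / 2)) ↔
      ∃ I : Finset (Fin P.length), ∑ i ∈ I, P.get i = P.sum / 2 := by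
  have hP : ∀ p ∈ P, 0 < p ∧ p < P.sum / 2 := fun p hp => ⟨hpos p hp, hlt p hp⟩
  have hsum : P.sum = 2 * (P.sum / 2) := by omega
  rw [sub_fin]
  constructor
  · intro h
    have hR := forward red blue green black hrb hrg hbg hkr hkb hkg P _ hP ht h
    obtain ⟨Q, hQ, e⟩ := reach_sub hR (by omega) (by omega) hlt (by omega)
    exact ⟨Q, hQ, by omega⟩
  · rintro ⟨Q, hQ, e⟩
    refine backward red blue green black hrb hrg hbg hkr hkb P _ hpos ht ?_
    exact reach_of hQ hpos (by omega) (by omega) (by omega) (by omega) (by omega)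

end Hexasort
end
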